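/- arXiv:2503.06055 — 8 statements merged into one kernel-verified Lean document; each statement's English description precedes it below -/
import Mathlib

section
/- Let E be a countably Dedekind complete Riesz space, let b ∈ E with 0 < b, and let V_b = [0, b]. Let S be an order continuous self-map on V_b. If S is concave on V_b (i.e., λ·Sv + (1−λ)·Sw ≤ S(λv + (1−λ)w) for all v, w ∈ V_b and λ ∈ [0,1]) and Sv ≠ v whenever v lies in the lower perimeter ∂V_b, then S has exactly one fixed point v̄ in V_b, and for every v ∈ V_b with v ≤ Sv the iterates satisfy Sⁿv ↑ v̄ (the sequence (Sⁿv) is increasing with supremum v̄). -/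
open Set

noncomputable section

/-- `x` is the supremum of the set `s` computed within the poset `V`. -/
def IsSupIn {E : Type*} [PartialOrder E] (V s : Set E) (x : E) : Prop :=
  x ∈ V ∧ (∀ y ∈ s, y ≤ x) ∧ ∀ z ∈ V, (∀ y ∈ s, y ≤ z) → x ≤ z

/-- `x` is the infimum of the set `s` computed within the poset `V`. -/
def IsInfIn {E : Type*} [PartialOrder E] (V s : Set E) (x : E) : Prop :=
  x ∈ V ∧ (∀ y ∈ s, x ≤ y) ∧ ∀ z ∈ V, (∀ y ∈ s, z ≤ y) → z ≤ x

/-- A subset `V` is countably chain complete: it is order bounded and every nonempty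
countable chain in `V` has a supremum and an infimum in `V`. -/
def CountablyChainComplete {E : Type*} [PartialOrder E] (V : Set E) : Prop :=
  (∃ a b : E, V ⊆ Set.Icc a b) ∧
    ∀ C : Set E, C ⊆ V → C.Countable → C.Nonempty → IsChain (· ≤ ·) C →
      (∃ x, IsSupIn V C x) ∧ ∃ x, IsInfIn V C x

/-- A self-map `S` on `V` is order continuous: whenever `(vₙ) ⊆ V` is increasing with
supremum `x` in `V`, the supremum of `(S vₙ)` exists in `V` and equals `S x`. -/
def OrderContinuousOn {E : Type*} [PartialOrder E] (S : E → E) (V : Set E) : Prop :=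
  ∀ (v : ℕ → E) (x : E), (∀ n, v n ∈ V) → Monotone v → IsSupIn V (Set.range v) x →
    IsSupIn V (Set.range fun n => S (v n)) (S x)

/-- An order continuous map on `V` is order preserving on `V`. -/
theorem OrderContinuousOn.monotoneOn {E : Type*} [PartialOrder E] {S : E → E} {V : Set E}
    (hcont : OrderContinuousOn S V) : MonotoneOn S V := by
  intro x hx y hy hxy
  have h := hcont (fun n => if n = 0 then x else y) y
    (fun n => by split_ifs <;> assumption)
    (monotone_nat_of_le_succ fun n => by
      split_ifs
      · simp_all
      · exact hxy
      · simp_all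
      · exact le_rfl)
    ⟨hy, by rintro _ ⟨n, rfl⟩; dsimp only; split_ifs <;> simp [hxy],
      fun z _ hz => hz y ⟨1, by simp⟩⟩
  exact h.2.1 (S x) ⟨0, by simp⟩

/-- The iterates of a self-map of `V` stay in `V`. -/
theorem iterate_mem_of_mapsTo {E : Type*} {S : E → E} {V : Set E}
    (hself : ∀ v ∈ V, S v ∈ V) {v : E} (hv : v ∈ V) (n : ℕ) : S^[n] v ∈ V := by
  induction n with
  | zero => exact hv
  | succ n ih => rw [Function.iterate_succ_apply']; exact hself _ ih

/-- The iterates of an order preserving self-map at a point with `v ≤ S v` increase. -/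
theorem monotone_iterate_of_le_self_map {E : Type*} [PartialOrder E] {S : E → E} {V : Set E}
    (hself : ∀ v ∈ V, S v ∈ V) (hmono : MonotoneOn S V) {v : E} (hv : v ∈ V) (hvS : v ≤ S v) :
    Monotone fun n => S^[n] v := by
  refine monotone_nat_of_le_succ fun n => ?_
  induction n with
  | zero => exact hvS
  | succ n ih =>
    simp only [Function.iterate_succ_apply'] at ih ⊢
    have hn := iterate_mem_of_mapsTo hself hv n
    exact hmono hn (hself _ hn) ih

/-- The supremum of increasing iterates of an order continuous self-map is a fixed point. -/
theorem OrderContinuousOn.isFixedPt_of_isSupIn_iterate {E : Type*} [PartialOrder E]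
    {S : E → E} {V : Set E} (hself : ∀ v ∈ V, S v ∈ V) (hcont : OrderContinuousOn S V)
    {v x : E} (hv : v ∈ V) (hvS : v ≤ S v) (hx : IsSupIn V (Set.range fun n => S^[n] v) x) :
    S x = x := by
  have hS := hcont _ x (iterate_mem_of_mapsTo hself hv)
    (monotone_iterate_of_le_self_map hself hcont.monotoneOn hv hvS) hx
  apply le_antisymm
  · refine hS.2.2 x hx.1 ?_
    rintro _ ⟨n, rfl⟩
    exact hx.2.1 _ ⟨n + 1, Function.iterate_succ_apply' S n v⟩
  · refine hx.2.2 _ hS.1 ?_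
    rintro _ ⟨n, rfl⟩
    cases n with
    | zero => exact hvS.trans (hS.2.1 _ ⟨0, rfl⟩)
    | succ n => exact hS.2.1 _ ⟨n, (Function.iterate_succ_apply' S n v).symm⟩

/-- If the extrapolation of the segment from `w` to `v` beyond `v` stays in the domain of a
concave map fixing `v` and `w`, the map sends the extrapolated point below itself. -/
theorem map_extrapolate_le {E : Type*} [AddCommGroup E] [Lattice E] [IsOrderedAddMonoid E]
    [Module ℝ E] [PosSMulMono ℝ E] {V : Set E} {S : E → E}
    (hconc : ∀ v ∈ V, ∀ w ∈ V, ∀ l : ℝ, 0 ≤ l → l ≤ 1 →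
      l • S v + (1 - l) • S w ≤ S (l • v + (1 - l) • w))
    {v w : E} (hw : w ∈ V) (hSv : S v = v) (hSw : S w = w) {a : ℝ} (ha : 0 < a)
    (hu : v - a • (w - v) ∈ V) : S (v - a • (w - v)) ≤ v - a • (w - v) := by
  set u := v - a • (w - v) with hu_def
  have ha' : 1 + a ≠ 0 := by positivity
  have hl : (0 : ℝ) ≤ (1 + a)⁻¹ := by positivity
  have hcomb : (1 + a)⁻¹ • u + (1 - (1 + a)⁻¹) • w = v := by
    rw [hu_def]
    match_scalars <;> field_simp <;> ring
  have h := hconc u hu w hw (1 + a)⁻¹ hl (inv_le_one_of_one_le₀ (by linarith))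
  rw [hcomb, hSv, hSw] at h
  have h' : (1 + a)⁻¹ • S u ≤ (1 + a)⁻¹ • u :=
    le_of_add_le_add_right (h.trans_eq hcomb.symm)
  simpa [smul_smul, ha'] using smul_le_smul_of_nonneg_left h' (by positivity : 0 ≤ 1 + a)

/-- Marinacci–Montrucchio fixed point theorem (Theorem t:mm): in a countably Dedekind
complete Riesz space `E`, if `S` is an order continuous concave self-map on `V_b = [0, b]`
(`0 < b`) with no fixed point on the lower perimeter, then `S` has exactly one fixed point
`v̄` in `V_b`, and `Sⁿ v ↑ v̄` whenever `v ∈ V_b` with `v ≤ S v`. -/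
theorem stmt0 {E : Type*} [AddCommGroup E] [Lattice E]
    [CovariantClass E E (· + ·) (· ≤ ·)] [Module ℝ E] [PosSMulMono ℝ E]
    (hE : ∀ a c : E, CountablyChainComplete (Set.Icc a c))
    (b : E) (hb : 0 < b)
    (V : Set E) (hV : V = Set.Icc (0 : E) b)
    (S : E → E)
    (hself : ∀ v ∈ V, S v ∈ V)
    (hcont : OrderContinuousOn S V)
    (hconc : ∀ v ∈ V, ∀ w ∈ V, ∀ l : ℝ, 0 ≤ l → l ≤ 1 →
      l • S v + (1 - l) • S w ≤ S (l • v + (1 - l) • w))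
    (hper : ∀ v ∈ V, (∀ α : ℝ, 0 ≤ α → α • b ≤ v → α = 0) → S v ≠ v) :
    ∃ vbar ∈ V, S vbar = vbar ∧ (∀ w ∈ V, S w = w → w = vbar) ∧
      ∀ v ∈ V, v ≤ S v →
        Monotone (fun n => S^[n] v) ∧
        IsSupIn V (Set.range fun n => S^[n] v) vbar := by
  have : IsOrderedAddMonoid E := { add_le_add_left := fun _ _ h c => by gcongr }
  have hmono := hcont.monotoneOn
  have h0V : (0 : E) ∈ V := by rw [hV]; exact ⟨le_rfl, hb.le⟩
  have hsup : ∀ v ∈ V, v ≤ S v → ∃ x, IsSupIn V (Set.range fun n => S^[n] v) x := by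
    intro v hv hvS
    have hC := (hE 0 b).2
    rw [← hV] at hC
    exact (hC _ (by rintro _ ⟨n, rfl⟩; exact iterate_mem_of_mapsTo hself hv n)
      (Set.countable_range _) (Set.range_nonempty _)
      (monotone_iterate_of_le_self_map hself hmono hv hvS).isChain_range).1
  have h0S : (0 : E) ≤ S 0 := by
    have := hself 0 h0V
    rw [hV] at this
    exact this.1
  obtain ⟨m, hm⟩ := hsup 0 h0V h0S
  have hfix : S m = m := hcont.isFixedPt_of_isSupIn_iterate hself h0V h0S hm
  have hleast : ∀ u ∈ V, S u ≤ u → m ≤ u := by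
    intro u hu hSu
    refine hm.2.2 u hu ?_
    rintro _ ⟨n, rfl⟩
    dsimp only
    induction n with
    | zero => rw [hV] at hu; exact hu.1
    | succ n ih =>
      rw [Function.iterate_succ_apply']
      exact (hmono (iterate_mem_of_mapsTo hself h0V n) hu ih).trans hSu
  obtain ⟨a, ha, ham⟩ : ∃ a : ℝ, 0 < a ∧ a • b ≤ m := by
    by_contra! hcon
    refine hper m hm.1 (fun α hα hαm => ?_) hfix
    by_contra hne
    exact hcon α (lt_of_le_of_ne hα (Ne.symm hne)) hαm
  have huniq : ∀ w ∈ V, S w = w → w = m := by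
    intro w hw hSw
    have hmw : m ≤ w := hleast w hw hSw.le
    have hmV : m ∈ Set.Icc 0 b := hV ▸ hm.1
    have hwV : w ∈ Set.Icc 0 b := hV ▸ hw
    have hnonneg : 0 ≤ a • (w - m) := smul_nonneg ha.le (sub_nonneg.2 hmw)
    have hu : m - a • (w - m) ∈ V := by
      rw [hV]
      refine ⟨sub_nonneg.2 ?_, (sub_le_self _ hnonneg).trans hmV.2⟩
      refine le_trans (smul_le_smul_of_nonneg_left ?_ ha.le) ham
      exact (sub_le_self _ hmV.1).trans hwV.2
    have hle := hleast _ hu (map_extrapolate_le hconc hw hfix hSw ha hu)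
    have hzero : a • (w - m) = 0 := le_antisymm ((le_sub_self_iff m).1 hle) hnonneg
    exact sub_eq_zero.1 ((smul_eq_zero.1 hzero).resolve_left ha.ne')
  refine ⟨m, hm.1, hfix, huniq, fun v hv hvS =>
    ⟨monotone_iterate_of_le_self_map hself hmono hv hvS, ?_⟩⟩
  obtain ⟨x, hx⟩ := hsup v hv hvS
  exact huniq x hx.1 (hcont.isFixedPt_of_isSupIn_iterate hself hv hvS hx) ▸ hx
end
end

section
/- Let E be a countably Dedekind complete Riesz space and let S be a self-map on E such that (i) there exist h ∈ E and an order continuous linear operator K on E with Sv = h + Kv for all v ∈ E, and (ii) there exist e ∈ E and ρ ∈ [0,1) with |h| ≤ e and Ke ≤ ρe. Then S has a unique fixed point v̄ in the order interval V := [−e/(1−ρ), e/(1−ρ)], and Sⁿv →o v̄ for every v ∈ V. -/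
open Set

noncomputable section

/-- Order convergence of a sequence to `x`. -/
def OrderConv {E : Type*} [Lattice E] [AddCommGroup E] (v : ℕ → E) (x : E) : Prop :=
  ∃ d : ℕ → E, Antitone d ∧ IsGLB (Set.range d) 0 ∧ ∀ n, |v n - x| ≤ d n

/-- A linear operator `K` is order continuous: `vₙ ↑ x` implies `K vₙ ↑ K x`. -/
def OrderContinuousLin {E : Type*} [AddCommGroup E] [Lattice E] [Module ℝ E]
    (K : E →ₗ[ℝ] E) : Prop :=
  ∀ (v : ℕ → E) (x : E), Monotone v → IsLUB (Set.range v) x →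
    IsLUB (Set.range fun n => K (v n)) (K x)

theorem OrderContinuousLin.monotone {E : Type*} [AddCommGroup E] [Lattice E]
    [IsOrderedAddMonoid E] [Module ℝ E] {K : E →ₗ[ℝ] E} (hK : OrderContinuousLin K) :
    Monotone K := by
  have map_nonneg : ∀ v : E, 0 ≤ v → 0 ≤ K v := by
    intro v hv
    have hmono : Monotone fun n : ℕ => if n = 0 then (0 : E) else v := by
      refine monotone_nat_of_le_succ fun n => ?_
      by_cases hn : n = 0 <;> simp [hn, hv]
    have hlub : IsLUB (Set.range fun n : ℕ => if n = 0 then (0 : E) else v) v := by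
      refine ⟨?_, fun z hz => by simpa using hz ⟨1, rfl⟩⟩
      rintro _ ⟨n, rfl⟩
      by_cases hn : n = 0 <;> simp [hn, hv]
    simpa using (hK _ _ hmono hlub).1 ⟨0, rfl⟩
  intro v w hvw
  have := map_nonneg (w - v) (sub_nonneg.2 hvw)
  rwa [map_sub, sub_nonneg] at this

theorem IsSupIn.isLUB {E : Type*} [Lattice E] {a c x : E} {s : Set E}
    (hx : IsSupIn (Set.Icc a c) s x) (hs : s ⊆ Set.Icc a c) (hne : s.Nonempty) :
    IsLUB s x := by
  refine ⟨hx.2.1, fun z hz => ?_⟩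
  obtain ⟨y, hy⟩ := hne
  have hmem : z ⊓ c ∈ Set.Icc a c :=
    ⟨le_inf ((hs hy).1.trans (hz hy)) ((hs hy).1.trans (hs hy).2), inf_le_right⟩
  exact (hx.2.2 _ hmem fun y hy => le_inf (hz hy) (hs hy).2).trans inf_le_left

theorem CountablyChainComplete.exists_isLUB_of_monotone {E : Type*} [Lattice E] {a c : E}
    (hE : CountablyChainComplete (Set.Icc a c)) {v : ℕ → E} (hv : Monotone v)
    (hmem : ∀ n, v n ∈ Set.Icc a c) : ∃ x ∈ Set.Icc a c, IsLUB (Set.range v) x := by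
  have hsub : Set.range v ⊆ Set.Icc a c := Set.range_subset_iff.2 hmem
  obtain ⟨x, hx⟩ :=
    (hE.2 _ hsub (Set.countable_range v) (Set.range_nonempty v) hv.isChain_range).1
  exact ⟨x, hx.1, hx.isLUB hsub (Set.range_nonempty v)⟩

/-- Geometric sequences decrease to zero in a countably Dedekind complete Riesz space. -/
theorem isGLB_range_pow_smul {E : Type*} [AddCommGroup E] [Lattice E]
    [IsOrderedAddMonoid E] [Module ℝ E] [PosSMulMono ℝ E]
    {ρ : ℝ} (hρ0 : 0 ≤ ρ) (hρ1 : ρ < 1) {c : E} (hc : 0 ≤ c)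
    (hE : CountablyChainComplete (Set.Icc 0 c)) :
    Antitone (fun n : ℕ => ρ ^ n • c) ∧ IsGLB (Set.range fun n : ℕ => ρ ^ n • c) 0 := by
  have hanti : Antitone (fun n : ℕ => ρ ^ n • c) := fun m n hmn =>
    smul_le_smul_of_nonneg_right (pow_le_pow_of_le_one hρ0 hρ1.le hmn) hc
  have hnonneg : ∀ n : ℕ, 0 ≤ ρ ^ n • c := fun n => smul_nonneg (pow_nonneg hρ0 n) hc
  have hle : ∀ n : ℕ, ρ ^ n • c ≤ c := fun n => by simpa using hanti (Nat.zero_le n)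
  refine ⟨hanti, Set.forall_mem_range.2 hnonneg, fun z hz => ?_⟩
  have hsub : (Set.range fun n : ℕ => ρ ^ n • c) ⊆ Set.Icc 0 c :=
    Set.range_subset_iff.2 fun n => ⟨hnonneg n, hle n⟩
  obtain ⟨x, ⟨hx0, -⟩, hxle, hxmax⟩ := (hE.2 _ hsub (Set.countable_range _)
    (Set.range_nonempty _) hanti.isChain_range).2
  have hxn : ∀ n : ℕ, x ≤ ρ ^ n • c := fun n => hxle _ ⟨n, rfl⟩
  have hxnonpos : x ≤ 0 := by
    rcases hρ0.eq_or_lt with rfl | hρpos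
    · simpa using hxn 1
    · have hlower : ∀ n : ℕ, ρ⁻¹ • x ≤ ρ ^ n • c := fun n => by
        have := smul_le_smul_of_nonneg_left (hxn (n + 1)) (inv_nonneg.2 hρ0)
        rwa [smul_smul, pow_succ', inv_mul_cancel_left₀ hρpos.ne'] at this
      have hinv : ρ⁻¹ • x ≤ x :=
        hxmax _ ⟨smul_nonneg (inv_nonneg.2 hρ0) hx0, (hlower 0).trans (hle 0)⟩
          (Set.forall_mem_range.2 hlower)
      have hsmul : x ≤ ρ • x := by
        have := smul_le_smul_of_nonneg_left hinv hρ0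
        rwa [smul_inv_smul₀ hρpos.ne'] at this
      have hpos : 0 < 1 - ρ := sub_pos.2 hρ1
      have hsub_smul : (1 - ρ) • x ≤ 0 := by
        rwa [sub_smul, one_smul, sub_nonpos]
      have := smul_le_smul_of_nonneg_left hsub_smul (inv_nonneg.2 hpos.le)
      rwa [smul_zero, inv_smul_smul₀ hpos.ne'] at this
  have hzx : z ⊔ 0 ≤ x :=
    hxmax _ ⟨le_sup_right, sup_le ((hz ⟨0, rfl⟩).trans (hle 0)) hc⟩
      fun y hy => sup_le (hz hy) (hsub hy).1
  exact le_sup_left.trans (hzx.trans hxnonpos)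

/-- Theorem t:nceccon: in a countably Dedekind complete Riesz space `E`, let
`S v = h + K v` with `K` an order continuous linear operator, and suppose there exist
`e ∈ E` and `ρ ∈ [0,1)` with `|h| ≤ e` and `K e ≤ ρ e`.  Then `S` has a unique fixed
point `v̄` in the order interval `V = [-e/(1-ρ), e/(1-ρ)]`, and `Sⁿ v →o v̄` for
every `v ∈ V`. -/
theorem stmt5 {E : Type*} [AddCommGroup E] [Lattice E]
    [CovariantClass E E (· + ·) (· ≤ ·)] [Module ℝ E] [PosSMulMono ℝ E]
    (hE : ∀ a c : E, CountablyChainComplete (Set.Icc a c))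
    (S : E → E) (h : E) (K : E →ₗ[ℝ] E)
    (hK : OrderContinuousLin K)
    (hS : ∀ v, S v = h + K v)
    (e : E) (ρ : ℝ) (hρ0 : 0 ≤ ρ) (hρ1 : ρ < 1)
    (hhe : |h| ≤ e) (hKe : K e ≤ ρ • e)
    (V : Set E) (hV : V = Set.Icc (-((1 - ρ)⁻¹ • e)) ((1 - ρ)⁻¹ • e)) :
    ∃ vbar ∈ V, S vbar = vbar ∧ (∀ w ∈ V, S w = w → w = vbar) ∧
      ∀ v ∈ V, OrderConv (fun n => S^[n] v) vbar := by
  have : IsOrderedAddMonoid E :=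
    { add_le_add_left := fun a b hab c => by
        rw [add_comm a c, add_comm b c]; exact CovariantClass.elim c hab }
  have hpos : 0 < 1 - ρ := sub_pos.2 hρ1
  set b := (1 - ρ)⁻¹ • e with hb
  have he : 0 ≤ e := (abs_nonneg h).trans hhe
  have hb0 : 0 ≤ b := smul_nonneg (inv_nonneg.2 hpos.le) he
  have hKb : K b ≤ ρ • b := by
    rw [hb, map_smul, smul_comm]
    exact smul_le_smul_of_nonneg_left hKe (inv_nonneg.2 hpos.le)
  have hsum : e + ρ • b = b := by
    have : e = (1 - ρ) • b := (smul_inv_smul₀ hpos.ne' e).symm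
    rw [this, sub_smul, one_smul, sub_add_cancel]
  have hSmono : Monotone S := fun v w hvw => by
    rw [hS, hS]
    exact add_le_add_right (hK.monotone hvw) h
  have hSb : S b ≤ b := by
    rw [hS, ← hsum]
    nth_rw 1 [hsum]
    exact add_le_add ((le_abs_self h).trans hhe) hKb
  have hSnegb : -b ≤ S (-b) := by
    rw [hS, map_neg, ← sub_eq_add_neg, neg_le, neg_sub, sub_eq_add_neg, add_comm]
    calc -h + K b ≤ e + ρ • b := add_le_add ((neg_le_abs h).trans hhe) hKb
      _ = b := hsum
  have hbounds : ∀ v ∈ V, ∀ n, S^[n] (-b) ≤ S^[n] v ∧ S^[n] v ≤ S^[n] b := by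
    intro v hv n
    rw [hV] at hv
    exact ⟨hSmono.iterate n hv.1, hSmono.iterate n hv.2⟩
  have hgap : ∀ n, S^[n] b - S^[n] (-b) ≤ ρ ^ n • (b + b) := by
    intro n
    induction n with
    | zero => simp
    | succ n ih =>
      rw [Function.iterate_succ_apply', Function.iterate_succ_apply', hS, hS,
        add_sub_add_left_eq_sub, ← map_sub]
      calc K (S^[n] b - S^[n] (-b)) ≤ K (ρ ^ n • (b + b)) := hK.monotone ih
        _ = ρ ^ n • (K b + K b) := by rw [map_smul, map_add]
        _ ≤ ρ ^ n • (ρ • b + ρ • b) :=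
          smul_le_smul_of_nonneg_left (add_le_add hKb hKb) (pow_nonneg hρ0 n)
        _ = ρ ^ (n + 1) • (b + b) := by rw [← smul_add, smul_smul, pow_succ]
  obtain ⟨hanti, hglb⟩ := isGLB_range_pow_smul hρ0 hρ1 (add_nonneg hb0 hb0) (hE 0 (b + b))
  have hlmono : Monotone fun n => S^[n] (-b) :=
    hSmono.monotone_iterate_of_le_map hSnegb
  have humono : Antitone fun n => S^[n] b :=
    hSmono.antitone_iterate_of_map_le hSb
  have hnegb : -b ≤ b := (neg_nonpos.2 hb0).trans hb0
  have hlmem : ∀ n, S^[n] (-b) ∈ Set.Icc (-b) b := fun n =>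
    ⟨hlmono (Nat.zero_le n), (hSmono.iterate n hnegb).trans (humono (Nat.zero_le n))⟩
  obtain ⟨x, hxmem, hx⟩ := (hE (-b) b).exists_isLUB_of_monotone hlmono hlmem
  have hxV : x ∈ V := hV ▸ hxmem
  have hKx := hK _ _ hlmono hx
  have hfix : S x = x := by
    apply le_antisymm
    · have hle : K x ≤ x - h := hKx.2 (Set.forall_mem_range.2 fun n => by
        have := hx.1 ⟨n + 1, rfl⟩
        simp only [Function.iterate_succ_apply', hS (S^[n] (-b))] at this
        rwa [le_sub_iff_add_le'])
      rw [hS]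
      exact le_sub_iff_add_le'.1 hle
    · refine hx.2 (Set.forall_mem_range.2 fun n => ?_)
      calc S^[n] (-b) ≤ S^[n + 1] (-b) := hlmono n.le_succ
        _ = S (S^[n] (-b)) := Function.iterate_succ_apply' ..
        _ ≤ S x := hSmono (hx.1 ⟨n, rfl⟩)
  have hdist : ∀ v ∈ V, ∀ n, |S^[n] v - x| ≤ ρ ^ n • (b + b) := by
    intro v hv n
    have hxb := hbounds x hxV n
    rw [Function.iterate_fixed hfix] at hxb
    obtain ⟨hlv, hvu⟩ := hbounds v hv n
    refine le_trans (abs_le'.2 ⟨sub_le_sub hvu hxb.1, ?_⟩) (hgap n)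
    rw [neg_sub]
    exact sub_le_sub hxb.2 hlv
  refine ⟨x, hxV, hfix, fun w hw hSw => ?_, fun v hv => ⟨_, hanti, hglb, hdist v hv⟩⟩
  have hzero : |w - x| ≤ 0 := hglb.2 (Set.forall_mem_range.2 fun n => by
    simpa [Function.iterate_fixed hSw] using hdist w hw n)
  obtain ⟨hle, hge⟩ := abs_le'.1 hzero
  rw [neg_sub] at hge
  exact le_antisymm (sub_nonpos.1 hle) (sub_nonpos.1 hge)
end
end

section
/- Let (B, ℬ) and (S, 𝒮) be measurable spaces with B ⊆ [b₁, b₂] ⊂ (0, ∞), let Q be a stochastic kernel on B and P a stochastic kernel on S, let X := B × S, and let K act on bmX via (Kf)(b, s) = ∫∫ b′ f(b′, s′) Q(b, db′) P(s, ds′). Suppose π ∈ bmX depends only on s, satisfies π₀ := inf_{s∈S} π(s) > 0, and there exist positive constants α, λ with ∫ π(s′) P(s, ds′) ≤ απ(s) + λ for all s ∈ S and α + λ/π₀ < 1/b₂. Define e(b, s) := (b₂/b)π(s). Then ρ := b₂(α + λ/π₀) satisfies ρ ∈ [0, 1) and Ke ≤ ρe. -/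
open Set MeasureTheory ProbabilityTheory

noncomputable section

/-- `f` belongs to `bmX`: `f` is a bounded measurable real-valued function. -/
def bm {X : Type*} [MeasurableSpace X] (f : X → ℝ) : Prop :=
  Measurable f ∧ ∃ M : ℝ, ∀ x, |f x| ≤ M

/-- Lemma l:rho: with `B ⊆ [b₁, b₂] ⊂ (0, ∞)`, stochastic kernels `Q` on `B` and `P`
on `S`, π ∈ bmX depending only on `s` with infimum `π₀ > 0`, drift condition
`∫ π(s') P(s, ds') ≤ α π(s) + λ` with `α, λ > 0` and `α + λ/π₀ < 1/b₂`, and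
`e(b, s) = (b₂ / b) π(s)`, the constant `ρ := b₂ (α + λ/π₀)` satisfies `ρ ∈ [0, 1)`
and `K e ≤ ρ e`, where `(Kf)(b, s) = ∫∫ b' f(b', s') Q(b, db') P(s, ds')`. -/
theorem stmt8 {Bs : Set ℝ} {Sp : Type*} [MeasurableSpace Sp]
    (b₁ b₂ : ℝ) (hb₁ : 0 < b₁) (hB : Bs ⊆ Set.Icc b₁ b₂)
    (Q : Kernel Bs Bs) [IsMarkovKernel Q]
    (P : Kernel Sp Sp) [IsMarkovKernel P]
    (π : Sp → ℝ) (hπm : Measurable π) (Mπ : ℝ) (hπb : ∀ s, |π s| ≤ Mπ)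
    (π₀ : ℝ) (hπ₀glb : IsGLB (Set.range π) π₀) (hπ₀ : 0 < π₀)
    (α lam : ℝ) (hα : 0 < α) (hlam : 0 < lam)
    (hdrift : ∀ s : Sp, ∫ s', π s' ∂(P s) ≤ α * π s + lam)
    (hsmall : α + lam / π₀ < 1 / b₂)
    (K : (Bs × Sp → ℝ) → (Bs × Sp → ℝ))
    (hK : ∀ (f : Bs × Sp → ℝ) (b : Bs) (s : Sp),
      K f (b, s) = ∫ s', ∫ b', (b' : ℝ) * f (b', s') ∂(Q b) ∂(P s))
    (e : Bs × Sp → ℝ) (he : ∀ p : Bs × Sp, e p = (b₂ / (p.1 : ℝ)) * π p.2) :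
    0 ≤ b₂ * (α + lam / π₀) ∧ b₂ * (α + lam / π₀) < 1 ∧
      ∀ p : Bs × Sp, K e p ≤ b₂ * (α + lam / π₀) * e p := by
  have hb₂ : 0 < b₂ := by
    have h : 0 < α + lam / π₀ := by positivity
    exact one_div_pos.mp (h.trans hsmall)
  refine ⟨by positivity, ?_, ?_⟩
  · rwa [lt_div_iff₀ hb₂, mul_comm] at hsmall
  rintro ⟨b, s⟩
  have hπ : π₀ ≤ π s := hπ₀glb.1 ⟨s, rfl⟩
  have hπs : 0 < π s := hπ₀.trans_le hπ
  have hpos : ∀ b' : Bs, 0 < (b' : ℝ) := fun b' => hb₁.trans_le (hB b'.2).1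
  have hK_eq : K e (b, s) = b₂ * ∫ s', π s' ∂(P s) := by
    have hcancel : ∀ (b' : Bs) (s' : Sp), (b' : ℝ) * e (b', s') = b₂ * π s' := by
      intro b' s'
      have := (hpos b').ne'
      rw [he]
      field_simp
    rw [hK]
    simp [hcancel, integral_const_mul]
  have he_ge : π s ≤ e (b, s) := by
    rw [he]
    exact le_mul_of_one_le_left hπs.le ((one_le_div (hpos b)).mpr (hB b.2).2)
  have hlam_le : lam ≤ lam / π₀ * π s := by
    rw [div_mul_eq_mul_div, le_div_iff₀ hπ₀]
    gcongr
  calc K e (b, s) = b₂ * ∫ s', π s' ∂(P s) := hK_eq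
    _ ≤ b₂ * (α * π s + lam) := by gcongr; exact hdrift s
    _ ≤ b₂ * (α * π s + lam / π₀ * π s) := by gcongr
    _ = b₂ * (α + lam / π₀) * π s := by ring
    _ ≤ b₂ * (α + lam / π₀) * e (b, s) := by gcongr
end
end

section
/- Let (B, ℬ) and (S, 𝒮) be measurable spaces with B ⊆ [b₁, b₂] ⊂ (0, ∞), let Q be a stochastic kernel on B and P a stochastic kernel on S, and let X := B × S. Suppose π ∈ bmX depends only on s, satisfies π₀ := inf_{s∈S} π(s) > 0, and there exist positive constants α, λ with ∫ π(s′) P(s, ds′) ≤ απ(s) + λ for all s and α + λ/π₀ < 1/b₂. Define K on bmX by (Kf)(b, s) = ∫∫ b′ f(b′, s′) Q(b, db′) P(s, ds′), define Sv := π + Kv, let e(b, s) := (b₂/b)π(s), and ρ := b₂(α + λ/π₀). Then (i) there exists v* ∈ bmX with v* = π + Kv* (a solution to the data valuation problem), and (ii) Sⁿv →o v* for every v in the order interval [−e/(1−ρ), e/(1−ρ)] ⊂ bmX. -/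
open Set MeasureTheory ProbabilityTheory

noncomputable section

/-- Order convergence in the Riesz space `bmX`: there is a decreasing sequence `(dₙ)`
in `bmX` whose infimum in `bmX` is `0`, dominating `|vₙ - x|`. -/
def bmOrderConv {X : Type*} [MeasurableSpace X] (v : ℕ → X → ℝ) (x : X → ℝ) : Prop :=
  ∃ d : ℕ → X → ℝ, (∀ n, bm (d n)) ∧ Antitone d ∧
    (∀ n, (0 : X → ℝ) ≤ d n) ∧
    (∀ w : X → ℝ, bm w → (∀ n, w ≤ d n) → w ≤ 0) ∧
    ∀ n, |v n - x| ≤ d n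

theorem bm.add {X : Type*} [MeasurableSpace X] {f g : X → ℝ} (hf : bm f) (hg : bm g) :
    bm (fun x => f x + g x) := by
  obtain ⟨hfm, M, hM⟩ := hf
  obtain ⟨hgm, N, hN⟩ := hg
  exact ⟨hfm.add hgm, M + N, fun x => (abs_add_le _ _).trans (add_le_add (hM x) (hN x))⟩

theorem bm.sub {X : Type*} [MeasurableSpace X] {f g : X → ℝ} (hf : bm f) (hg : bm g) :
    bm (fun x => f x - g x) := by
  obtain ⟨hfm, M, hM⟩ := hf
  obtain ⟨hgm, N, hN⟩ := hg
  exact ⟨hfm.sub hgm, M + N, fun x => (abs_sub _ _).trans (add_le_add (hM x) (hN x))⟩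

theorem bm.mul {X : Type*} [MeasurableSpace X] {f g : X → ℝ} (hf : bm f) (hg : bm g) :
    bm (fun x => f x * g x) := by
  obtain ⟨hfm, M, hM⟩ := hf
  obtain ⟨hgm, N, hN⟩ := hg
  refine ⟨hfm.mul hgm, M * N, fun x => ?_⟩
  rw [abs_mul]
  exact mul_le_mul (hM x) (hN x) (abs_nonneg _) ((abs_nonneg _).trans (hM x))

theorem bm.const_mul {X : Type*} [MeasurableSpace X] {f : X → ℝ} (hf : bm f) (c : ℝ) :
    bm (fun x => c * f x) :=
  bm.mul (f := fun _ => c) ⟨measurable_const, |c|, fun _ => le_rfl⟩ hf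

theorem bm.integrable {X : Type*} [MeasurableSpace X] {f : X → ℝ} (hf : bm f)
    (μ : Measure X) [IsFiniteMeasure μ] : Integrable f μ := by
  obtain ⟨hfm, M, hM⟩ := hf
  exact Integrable.of_bound hfm.aestronglyMeasurable M (ae_of_all _ hM)

/-- A function dominated by a multiple of a bounded weight is bounded. -/
theorem bm.of_abs_le {X : Type*} [MeasurableSpace X] {f g : X → ℝ} (hf : Measurable f)
    (hg : bm g) (h : ∀ x, |f x| ≤ g x) : bm f := by
  obtain ⟨-, M, hM⟩ := hg
  exact ⟨hf, M, fun x => (h x).trans ((le_abs_self _).trans (hM x))⟩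

/-- A self-map of `bmX` that contracts the weighted sup norm with weight `e` has a fixed point,
and its iterates order converge to it. -/
theorem exists_fixedPoint_bmOrderConv {X : Type*} [MeasurableSpace X]
    (S : (X → ℝ) → (X → ℝ)) (e : X → ℝ) (he : bm e) (ε : ℝ) (hε : 0 < ε) (hεe : ∀ x, ε ≤ e x)
    (ρ : ℝ) (hρ0 : 0 ≤ ρ) (hρ1 : ρ < 1) (hSbm : ∀ f, bm f → bm (S f))
    (hcontr : ∀ f g, bm f → bm g → ∀ c, 0 ≤ c → (∀ x, |f x - g x| ≤ c * e x) →
      ∀ x, |S f x - S g x| ≤ ρ * c * e x) :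
    ∃ w, bm w ∧ S w = w ∧ ∀ v, bm v → bmOrderConv (fun n => S^[n] v) w := by
  have hbound : ∀ f, bm f → ∃ c, 0 ≤ c ∧ ∀ x, |f x| ≤ c * e x := by
    rintro f ⟨-, M, hM⟩
    refine ⟨|M| / ε, by positivity, fun x => (hM x).trans ((le_abs_self M).trans ?_)⟩
    calc |M| = |M| / ε * ε := by field_simp
      _ ≤ |M| / ε * e x := by gcongr; exact hεe x
  have hit : ∀ f, bm f → ∀ n, bm (S^[n] f) := by
    intro f hf n
    induction n with
    | zero => exact hf
    | succ n ih => rw [Function.iterate_succ_apply']; exact hSbm _ ih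
  have hiter : ∀ f g, bm f → bm g → ∀ c, 0 ≤ c → (∀ x, |f x - g x| ≤ c * e x) →
      ∀ n x, |S^[n] f x - S^[n] g x| ≤ ρ ^ n * c * e x := by
    intro f g hf hg c hc h n
    induction n with
    | zero => simpa using h
    | succ n ih =>
      intro x
      rw [Function.iterate_succ_apply', Function.iterate_succ_apply']
      refine (hcontr _ _ (hit f hf n) (hit g hg n) _ (by positivity) ih x).trans_eq ?_
      ring
  have h0 : bm (fun _ : X => (0 : ℝ)) := ⟨measurable_const, 0, by simp⟩
  obtain ⟨c, hc, hc'⟩ := hbound _ ((hSbm _ h0).sub h0)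
  set u : ℕ → X → ℝ := fun n => S^[n] fun _ => 0 with hu
  have hustep : ∀ x n, dist (u n x) (u (n + 1) x) ≤ c * e x * ρ ^ n := by
    intro x n
    rw [dist_comm, Real.dist_eq, hu]
    simp only [Function.iterate_succ_apply]
    refine (hiter _ _ (hSbm _ h0) h0 c hc hc' n x).trans_eq ?_
    ring
  choose w hw using fun x =>
    cauchySeq_tendsto_of_complete (cauchySeq_of_le_geometric ρ _ hρ1 (hustep x))
  have hdist : ∀ n x, |u n x - w x| ≤ c * ρ ^ n / (1 - ρ) * e x := by
    intro n x
    refine (dist_le_of_le_geometric_of_tendsto ρ _ hρ1 (hustep x) (hw x) n).trans_eq ?_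
    ring
  have h1ρ : 0 < 1 - ρ := by linarith
  have hpow : Filter.Tendsto (fun n => ρ ^ n) Filter.atTop (nhds 0) :=
    tendsto_pow_atTop_nhds_zero_of_lt_one hρ0 hρ1
  have hwbm : bm w := by
    refine bm.of_abs_le (measurable_of_tendsto_metrizable (fun n => (hit _ h0 n).1)
      (tendsto_pi_nhds.2 hw)) (he.const_mul (c * ρ ^ 0 / (1 - ρ))) fun x => ?_
    simpa [hu] using hdist 0 x
  have hfix : S w = w := by
    funext x
    refine tendsto_nhds_unique ?_ ((Filter.tendsto_add_atTop_iff_nat 1).2 (hw x))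
    rw [tendsto_iff_dist_tendsto_zero]
    refine squeeze_zero (g := fun n => ρ ^ n * (ρ * (c / (1 - ρ)) * e x))
      (fun _ => dist_nonneg) (fun n => ?_) (by simpa using hpow.mul_const _)
    rw [Real.dist_eq, hu]
    simp only [Function.iterate_succ_apply']
    refine (hcontr _ _ (hit _ h0 n) hwbm _ (by positivity) (hdist n) x).trans_eq ?_
    ring
  refine ⟨w, hwbm, hfix, fun v hv => ?_⟩
  obtain ⟨a, ha, hva⟩ := hbound _ (hv.sub hwbm)
  have he0 : ∀ x, 0 ≤ e x := fun x => hε.le.trans (hεe x)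
  refine ⟨fun n x => ρ ^ n * a * e x, fun n => he.const_mul _, ?_, ?_, ?_, ?_⟩
  · intro m n hmn x
    have := he0 x
    have := pow_le_pow_of_le_one hρ0 hρ1.le hmn
    dsimp only
    gcongr
  · intro n x
    have := he0 x
    simp only [Pi.zero_apply]
    positivity
  · intro g _ hg x
    refine ge_of_tendsto' (f := fun n => ρ ^ n * (a * e x)) (b := g x) (x := Filter.atTop)
      (by simpa using hpow.mul_const (a * e x)) fun n => ?_
    exact (hg n x).trans_eq (mul_assoc _ _ _)
  · intro n x
    have := hiter v w hv hwbm a ha hva n x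
    rwa [Function.iterate_fixed hfix] at this

/-- Proposition p:vel: under Assumption a:dv there exists `v* ∈ bmX` solving the data
valuation problem `v* = π + K v*`, and `Sⁿ v →o v*` for every `v` in the order
interval `[-e/(1-ρ), e/(1-ρ)] ⊂ bmX`, where `S v = π + K v`,
`e(b,s) = (b₂/b) π(s)` and `ρ = b₂ (α + λ/π₀)`. -/
theorem stmt9 {Bs : Set ℝ} {Sp : Type*} [MeasurableSpace Sp]
    (b₁ b₂ : ℝ) (hb₁ : 0 < b₁) (hB : Bs ⊆ Set.Icc b₁ b₂)
    (Q : Kernel Bs Bs) [IsMarkovKernel Q]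
    (P : Kernel Sp Sp) [IsMarkovKernel P]
    (π : Sp → ℝ) (hπm : Measurable π) (Mπ : ℝ) (hπb : ∀ s, |π s| ≤ Mπ)
    (π₀ : ℝ) (hπ₀glb : IsGLB (Set.range π) π₀) (hπ₀ : 0 < π₀)
    (α lam : ℝ) (hα : 0 < α) (hlam : 0 < lam)
    (hdrift : ∀ s : Sp, ∫ s', π s' ∂(P s) ≤ α * π s + lam)
    (hsmall : α + lam / π₀ < 1 / b₂)
    (K : (Bs × Sp → ℝ) → (Bs × Sp → ℝ))
    (hK : ∀ (f : Bs × Sp → ℝ) (b : Bs) (s : Sp),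
      K f (b, s) = ∫ s', ∫ b', (b' : ℝ) * f (b', s') ∂(Q b) ∂(P s))
    (S : (Bs × Sp → ℝ) → (Bs × Sp → ℝ))
    (hS : ∀ (f : Bs × Sp → ℝ) (p : Bs × Sp), S f p = π p.2 + K f p)
    (e : Bs × Sp → ℝ) (he : ∀ p : Bs × Sp, e p = (b₂ / (p.1 : ℝ)) * π p.2)
    (ρ : ℝ) (hρ : ρ = b₂ * (α + lam / π₀)) :
    ∃ vstar : Bs × Sp → ℝ, bm vstar ∧ (∀ p, vstar p = π p.2 + K vstar p) ∧
      ∀ v : Bs × Sp → ℝ, bm v →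
        -((1 - ρ)⁻¹ • e) ≤ v → v ≤ (1 - ρ)⁻¹ • e →
        bmOrderConv (fun n => S^[n] v) vstar := by
  have hb₂ : 0 < b₂ := by
    have : 0 < α + lam / π₀ := by positivity
    exact one_div_pos.1 (this.trans hsmall)
  have hρ0 : 0 ≤ ρ := by rw [hρ]; positivity
  have hρ1 : ρ < 1 := by
    rw [lt_div_iff₀ hb₂] at hsmall
    linarith
  have hb : ∀ b : Bs, b₁ ≤ (b : ℝ) ∧ (b : ℝ) ≤ b₂ := fun b => hB b.2
  have hbpos : ∀ b : Bs, 0 < (b : ℝ) := fun b => hb₁.trans_le (hb b).1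
  have hπle : ∀ s, π₀ ≤ π s := fun s => hπ₀glb.1 (mem_range_self s)
  have hbbm : bm (fun p : Bs × Sp => (p.1 : ℝ)) :=
    ⟨by fun_prop, b₂, fun p => by rw [abs_of_pos (hbpos _)]; exact (hb _).2⟩
  have hπbm : bm (fun p : Bs × Sp => π p.2) := ⟨by fun_prop, Mπ, fun p => hπb _⟩
  have hπe : ∀ p, π p.2 ≤ e p := by
    intro p
    rw [he]
    exact le_mul_of_one_le_left (hπ₀.le.trans (hπle _)) ((one_le_div (hbpos _)).2 (hb _).2)
  have hebm : bm e := by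
    have hinv : bm (fun p : Bs × Sp => b₂ / (p.1 : ℝ)) := by
      refine ⟨by fun_prop, b₂ / b₁, fun p => ?_⟩
      rw [abs_of_nonneg (div_nonneg hb₂.le (hbpos _).le)]
      exact div_le_div_of_nonneg_left hb₂.le hb₁ (hb _).1
    rw [funext he]
    exact hinv.mul hπbm
  have hKint : ∀ f, bm f → ∀ p, K f p = ∫ q, (q.1 : ℝ) * f q ∂((Q ∥ₖ P) p) := by
    rintro f hf ⟨b, s⟩
    rw [hK, Kernel.parallelComp_apply, integral_prod_symm _ ((hbbm.mul hf).integrable _)]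
  have hKe : ∀ p, K e p ≤ ρ * e p := by
    rintro ⟨b, s⟩
    have hcancel : ∀ s' : Sp, ∀ b' : Bs, (b' : ℝ) * e (b', s') = b₂ * π s' := by
      intro s' b'
      have := (hbpos b').ne'
      rw [he]
      field_simp
    rw [hK]
    simp only [hcancel, integral_const, probReal_univ, one_smul, integral_const_mul]
    have hlam' : lam ≤ lam / π₀ * π s := by
      rw [div_mul_eq_mul_div, le_div_iff₀ hπ₀]
      exact mul_le_mul_of_nonneg_left (hπle s) hlam.le
    calc b₂ * ∫ s', π s' ∂(P s) ≤ b₂ * (α * π s + lam / π₀ * π s) := by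
          gcongr
          exact (hdrift s).trans (by linarith)
      _ = ρ * π s := by rw [hρ]; ring
      _ ≤ ρ * e (b, s) := mul_le_mul_of_nonneg_left (hπe (b, s)) hρ0
  have hKle : ∀ f, bm f → ∀ c, 0 ≤ c → (∀ x, |f x| ≤ c * e x) →
      ∀ x, |K f x| ≤ ρ * c * e x := by
    intro f hf c hc h x
    calc |K f x| ≤ ∫ q, c * ((q.1 : ℝ) * e q) ∂((Q ∥ₖ P) x) := by
          rw [hKint f hf, ← Real.norm_eq_abs]
          refine norm_integral_le_of_norm_le
            (((hbbm.mul hebm).const_mul c).integrable _) (ae_of_all _ fun q => ?_)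
          rw [Real.norm_eq_abs, abs_mul, abs_of_pos (hbpos _), mul_left_comm]
          exact mul_le_mul_of_nonneg_left (h q) (hbpos _).le
      _ = c * K e x := by rw [integral_const_mul, hKint e hebm]
      _ ≤ c * (ρ * e x) := mul_le_mul_of_nonneg_left (hKe x) hc
      _ = ρ * c * e x := by ring
  have hKsub : ∀ f g, bm f → bm g → ∀ x, K (fun y => f y - g y) x = K f x - K g x := by
    intro f g hf hg x
    rw [hKint _ (hf.sub hg), hKint f hf, hKint g hg,
      ← integral_sub ((hbbm.mul hf).integrable _) ((hbbm.mul hg).integrable _)]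
    simp only [mul_sub]
  have hKbm : ∀ f, bm f → bm (K f) := by
    intro f hf
    have hm : Measurable (K f) := by
      rw [funext (hKint f hf)]
      exact (hbbm.mul hf).1.stronglyMeasurable.integral_kernel.measurable
    obtain ⟨M, hM⟩ := hf.2
    refine bm.of_abs_le hm (hebm.const_mul (ρ * (|M| / π₀)))
      (hKle f hf _ (by positivity) fun x => (hM x).trans ((le_abs_self M).trans ?_))
    calc |M| = |M| / π₀ * π₀ := by field_simp
      _ ≤ |M| / π₀ * e x := by gcongr; exact (hπle _).trans (hπe x)
  obtain ⟨w, hw, hfix, hconv⟩ := exists_fixedPoint_bmOrderConv S e hebm π₀ hπ₀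
    (fun p => (hπle _).trans (hπe p)) ρ hρ0 hρ1
    (fun f hf => by rw [funext (hS f)]; exact hπbm.add (hKbm f hf))
    (fun f g hf hg c hc h x => by
      rw [hS, hS, add_sub_add_left_eq_sub, ← hKsub f g hf hg]
      exact hKle _ (hf.sub hg) c hc h x)
  exact ⟨w, hw, fun p => (congrFun hfix p).symm.trans (hS w p), fun v hv _ _ => hconv v hv⟩
end
end

section
/- Let E be a countably Dedekind complete Riesz space, let b ∈ E with 0 < b, let V = [0, b], and let (V, 𝕋) be a regular ADP with 𝕋 = {T_σ : σ ∈ Σ}. If every T_σ is order continuous on V, every T_σ is concave on V, and T_σ v ≠ v whenever v lies in the lower perimeter ∂V, then (V, 𝕋) is well-posed, the fundamental optimality properties (B1)–(B3) hold, and value function iteration converges: Tⁿv ↑ v* for every v ∈ V with v ≤ Tv, where T is the Bellman operator and v* the value function. -/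
open Set

noncomputable section

theorem IsSupIn.unique {E : Type*} [PartialOrder E] {V s : Set E} {x y : E}
    (hx : IsSupIn V s x) (hy : IsSupIn V s y) : x = y :=
  le_antisymm (hx.2.2 y hy.1 hy.2.1) (hy.2.2 x hx.1 hx.2.1)

theorem IsSupIn.of_forall_le {E : Type*} [PartialOrder E] {ι : Type*} {V : Set E} {f : ι → E}
    {i : ι} (hi : f i ∈ V) (h : ∀ j, f j ≤ f i) : IsSupIn V (range f) (f i) :=
  ⟨hi, by rintro _ ⟨j, rfl⟩; exact h j, fun _ _ hz => hz _ ⟨i, rfl⟩⟩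

section ValueIteration

variable {E : Type*} [PartialOrder E] {V : Set E}

/-- An orbit of the Bellman operator that starts with an increase is monotone, and its supremum
solves the Bellman equation. -/
theorem exists_isSupIn_orbit (hV : CountablyChainComplete V) {Pol : Type*} {T : Pol → E → E}
    (hmono : ∀ σ, ∀ v ∈ V, ∀ w ∈ V, v ≤ w → T σ v ≤ T σ w)
    (hcont : ∀ σ, OrderContinuousOn (T σ) V) {w : ℕ → E} (h0 : w 0 ∈ V) (h01 : w 0 ≤ w 1)
    (hw : ∀ n, IsSupIn V (range fun σ => T σ (w n)) (w (n + 1))) :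
    Monotone w ∧ ∃ x, IsSupIn V (range w) x ∧ IsSupIn V (range fun σ => T σ x) x := by
  have hmem : ∀ n, w n ∈ V := fun n => by
    cases n with
    | zero => exact h0
    | succ n => exact (hw n).1
  have hle : ∀ n, w n ≤ w (n + 1) := fun n => by
    induction n with
    | zero => exact h01
    | succ n ih =>
      refine (hw n).2.2 _ (hmem _) ?_
      rintro _ ⟨σ, rfl⟩
      exact (hmono σ _ (hmem _) _ (hmem _) ih).trans ((hw (n + 1)).2.1 _ ⟨σ, rfl⟩)
  have hm : Monotone w := monotone_nat_of_le_succ hle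
  obtain ⟨x, hx⟩ := (hV.2 (range w) (range_subset_iff.2 hmem) (countable_range w)
    (range_nonempty w) hm.isChain_range).1
  refine ⟨hm, x, hx, hx.1, ?_, fun z hz hzT => hx.2.2 z hz ?_⟩
  · rintro _ ⟨σ, rfl⟩
    refine (hcont σ w x hmem hm hx).2.2 x hx.1 ?_
    rintro _ ⟨n, rfl⟩
    exact ((hw n).2.1 _ ⟨σ, rfl⟩).trans (hx.2.1 _ ⟨n + 1, rfl⟩)
  · rintro _ ⟨n, rfl⟩
    refine (hle n).trans ((hw n).2.2 z hz ?_)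
    rintro _ ⟨σ, rfl⟩
    exact (hmono σ _ (hmem n) _ hx.1 (hx.2.1 _ ⟨n, rfl⟩)).trans (hzT _ ⟨σ, rfl⟩)

/-- The supremum of the iterates from `v ≤ S v` is a fixed point above `v`, below every
`y ≥ v` with `S y ≤ y`. -/
theorem exists_fixedPoint_of_le (hV : CountablyChainComplete V) {S : E → E}
    (hself : ∀ v ∈ V, S v ∈ V) (hmono : ∀ v ∈ V, ∀ w ∈ V, v ≤ w → S v ≤ S w)
    (hcont : OrderContinuousOn S V) {v : E} (hv : v ∈ V) (hvS : v ≤ S v) :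
    ∃ x ∈ V, S x = x ∧ v ≤ x ∧ ∀ y ∈ V, v ≤ y → S y ≤ y → x ≤ y := by
  have hsucc : ∀ n, S^[n + 1] v = S (S^[n] v) := fun n => Function.iterate_succ_apply' S n v
  have hmem : ∀ n, S^[n] v ∈ V := fun n => by
    induction n with
    | zero => exact hv
    | succ n ih => rw [hsucc]; exact hself _ ih
  obtain ⟨-, x, hx, hSx⟩ := exists_isSupIn_orbit (T := fun _ : Unit => S) (w := fun n => S^[n] v)
    hV (fun _ => hmono) (fun _ => hcont) hv hvS fun n => by
      simp only [hsucc]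
      exact .of_forall_le (f := fun _ : Unit => S (S^[n] v)) (i := ()) (hself _ (hmem n))
        fun _ => le_rfl
  refine ⟨x, hx.1, (IsSupIn.of_forall_le (f := fun _ : Unit => S x) (i := ()) (hself x hx.1)
    fun _ => le_rfl).unique hSx, hx.2.1 _ ⟨0, rfl⟩, fun y hy hvy hSy => hx.2.2 y hy ?_⟩
  rintro _ ⟨n, rfl⟩
  induction n with
  | zero => exact hvy
  | succ n ih => simp only [hsucc]; exact (hmono _ (hmem n) _ hy ih).trans hSy

end ValueIteration

/-- An order continuous concave monotone self-map of `[0, b]` without fixed points on the lower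
perimeter has exactly one fixed point, and it lies below every `y` with `S y ≤ y`. -/
theorem exists_unique_fixedPoint_of_concave {E : Type*} [AddCommGroup E] [PartialOrder E]
    [IsOrderedAddMonoid E] [Module ℝ E] [PosSMulMono ℝ E] {b : E} (hb : 0 ≤ b)
    (hV : CountablyChainComplete (Icc 0 b)) {S : E → E} (hself : ∀ v ∈ Icc 0 b, S v ∈ Icc 0 b)
    (hmono : ∀ v ∈ Icc 0 b, ∀ w ∈ Icc 0 b, v ≤ w → S v ≤ S w)
    (hcont : OrderContinuousOn S (Icc 0 b))
    (hconc : ∀ v ∈ Icc 0 b, ∀ w ∈ Icc 0 b, ∀ l : ℝ, 0 ≤ l → l ≤ 1 →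
      l • S v + (1 - l) • S w ≤ S (l • v + (1 - l) • w))
    (hper : ∀ v ∈ Icc 0 b, (∀ α : ℝ, 0 ≤ α → α • b ≤ v → α = 0) → S v ≠ v) :
    ∃ x ∈ Icc 0 b, S x = x ∧ (∀ w ∈ Icc 0 b, S w = w → w = x) ∧
      ∀ y ∈ Icc 0 b, S y ≤ y → x ≤ y := by
  have h0 : (0 : E) ∈ Icc 0 b := ⟨le_rfl, hb⟩
  obtain ⟨x, hx, hSx, -, hmin⟩ := exists_fixedPoint_of_le hV hself hmono hcont h0 (hself 0 h0).1
  have hleast : ∀ y ∈ Icc 0 b, S y ≤ y → x ≤ y := fun y hy hSy => hmin y hy hy.1 hSy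
  refine ⟨x, hx, hSx, fun w hw hSw => ?_, hleast⟩
  have hxw : x ≤ w := hleast w hw hSw.le
  obtain ⟨t, ht0, ht1, htb⟩ : ∃ t : ℝ, 0 < t ∧ t < 1 ∧ t • b ≤ x := by
    by_contra! h
    refine hper x hx (fun α hα hαb => ?_) hSx
    by_contra hne
    have hα0 : 0 < α := lt_of_le_of_ne hα (Ne.symm hne)
    refine h (min α (1 / 2)) (by positivity)
      ((min_le_right _ _).trans_lt (by norm_num)) (le_trans ?_ hαb)
    rw [← sub_nonneg, ← sub_smul]
    exact smul_nonneg (sub_nonneg.2 (min_le_left _ _)) hb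
  have ht1' : (0 : ℝ) < 1 - t := by linarith
  -- `x` lies on the segment from `w` to the point `y`, and `y` is again a supersolution.
  set y : E := (1 - t)⁻¹ • (x - t • w) with hy
  have hyx : (1 - t) • y = x - t • w := by rw [hy, smul_smul, mul_inv_cancel₀ ht1'.ne', one_smul]
  have cancel : ∀ {c : ℝ} {u v : E}, 0 < c → c • u ≤ c • v → u ≤ v := fun {c u v} hc h => by
    simpa [smul_smul, inv_mul_cancel₀ hc.ne'] using
      smul_le_smul_of_nonneg_left h (inv_nonneg.2 hc.le)
  have htw : t • x ≤ t • w := smul_le_smul_of_nonneg_left hxw ht0.le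
  have hyV : y ∈ Icc 0 b := by
    constructor
    · exact smul_nonneg (inv_nonneg.2 ht1'.le)
        (sub_nonneg.2 ((smul_le_smul_of_nonneg_left hw.2 ht0.le).trans htb))
    · refine le_trans (cancel ht1' ?_) hx.2
      rw [hyx, sub_smul, one_smul]
      exact sub_le_sub_left htw x
  have hSy : S y ≤ y := by
    refine cancel ht1' ?_
    have h := hconc w hw y hyV t ht0.le ht1.le
    rw [hyx, add_sub_cancel, hSx, hSw] at h
    rw [hyx]
    exact le_sub_iff_add_le'.2 h
  have h := smul_le_smul_of_nonneg_left (hleast y hyV hSy) ht1'.le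
  rw [hyx, sub_smul, one_smul, sub_le_sub_iff_left] at h
  exact le_antisymm (cancel ht0 h) hxw

/-- Theorem t:riesz_con: let `E` be a countably Dedekind complete Riesz space,
`0 < b`, `V = [0, b]`, and let `(V, 𝕋)` be a regular ADP with policy operators
`T σ`.  If each `T σ` is order continuous and concave on `V` and has no fixed point
on the lower perimeter `∂V`, then `(V, 𝕋)` is well-posed (each `T σ` has a unique
fixed point `vfix σ ∈ V`), the fundamental optimality properties (B1)–(B3) hold,
and value function iteration converges: every orbit of the Bellman operator starting
from `v ∈ V` with `v ≤ T v` increases up to the value function `v*`. -/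
theorem stmt10 {E : Type*} [AddCommGroup E] [Lattice E]
    [CovariantClass E E (· + ·) (· ≤ ·)] [Module ℝ E] [PosSMulMono ℝ E]
    (hE : ∀ a c : E, CountablyChainComplete (Set.Icc a c))
    (b : E) (hb : 0 < b)
    (V : Set E) (hV : V = Set.Icc (0 : E) b)
    {Pol : Type*} [Nonempty Pol] (T : Pol → E → E)
    (hself : ∀ σ, ∀ v ∈ V, T σ v ∈ V)
    (hmono : ∀ σ, ∀ v ∈ V, ∀ w ∈ V, v ≤ w → T σ v ≤ T σ w)
    (hreg : ∀ v ∈ V, ∃ σ, ∀ τ, T τ v ≤ T σ v)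
    (hcont : ∀ σ, OrderContinuousOn (T σ) V)
    (hconc : ∀ σ, ∀ v ∈ V, ∀ w ∈ V, ∀ l : ℝ, 0 ≤ l → l ≤ 1 →
      l • T σ v + (1 - l) • T σ w ≤ T σ (l • v + (1 - l) • w))
    (hper : ∀ σ, ∀ v ∈ V, (∀ α : ℝ, 0 ≤ α → α • b ≤ v → α = 0) → T σ v ≠ v) :
    ∃ vfix : Pol → E,
      -- well-posedness: each policy operator has a unique fixed point in V
      (∀ σ, vfix σ ∈ V ∧ T σ (vfix σ) = vfix σ ∧
        ∀ w ∈ V, T σ w = w → w = vfix σ) ∧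
      -- (B1): an optimal policy exists, and v* = vfix σopt is the value function
      ∃ σopt : Pol, (∀ τ, vfix τ ≤ vfix σopt) ∧
        -- (B2): v* is the unique solution of the Bellman equation in V
        IsSupIn V (Set.range fun σ => T σ (vfix σopt)) (vfix σopt) ∧
        (∀ w ∈ V, IsSupIn V (Set.range fun σ => T σ w) w → w = vfix σopt) ∧
        -- (B3): Bellman's principle of optimality
        (∀ σ, (∀ τ, vfix τ ≤ vfix σ) ↔ (∀ τ, T τ (vfix σopt) ≤ T σ (vfix σopt))) ∧
        -- convergence of VFI
        ∀ w : ℕ → E, w 0 ∈ V → w 0 ≤ w 1 →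
          (∀ n, IsSupIn V (Set.range fun σ => T σ (w n)) (w (n + 1))) →
          Monotone w ∧ IsSupIn V (Set.range w) (vfix σopt) := by
  subst hV
  have : IsOrderedAddMonoid E :=
    { add_le_add_left := fun a c h d => by
        rw [add_comm a, add_comm c]; exact CovariantClass.elim d h }
  have hVc := hE 0 b
  have h0 : (0 : E) ∈ Icc 0 b := ⟨le_rfl, hb.le⟩
  choose vfix hmem hfix huniq hleast using fun σ => exists_unique_fixedPoint_of_concave hb.le hVc
    (hself σ) (hmono σ) (hcont σ) (hconc σ) (hper σ)
  choose! g hg using hreg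
  -- A solution of the Bellman equation is the greatest policy value.
  have bellman : ∀ x ∈ Icc 0 b, IsSupIn (Icc 0 b) (range fun σ => T σ x) x →
      x = vfix (g x) ∧ ∀ τ, vfix τ ≤ x := fun x hx hsup =>
    ⟨huniq _ x hx ((IsSupIn.of_forall_le (f := fun σ => T σ x) (hself (g x) x hx)
      (hg x hx)).unique hsup), fun τ => hleast τ x hx (hsup.2.1 _ ⟨τ, rfl⟩)⟩
  have bellman_unique : ∀ x ∈ Icc 0 b, ∀ y ∈ Icc 0 b,
      IsSupIn (Icc 0 b) (range fun σ => T σ x) x → IsSupIn (Icc 0 b) (range fun σ => T σ y) y →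
      x = y := fun x hx y hy hxs hys => by
    obtain ⟨hx1, hx2⟩ := bellman x hx hxs
    obtain ⟨hy1, hy2⟩ := bellman y hy hys
    exact le_antisymm (hx1.trans_le (hy2 _)) (hy1.trans_le (hx2 _))
  let w : ℕ → E := fun n => (fun v => T (g v) v)^[n] 0
  have hsucc : ∀ n, w (n + 1) = T (g (w n)) (w n) := fun n => Function.iterate_succ_apply' _ n 0
  have hwV : ∀ n, w n ∈ Icc 0 b := fun n => by
    induction n with
    | zero => exact h0
    | succ n ih => rw [hsucc]; exact hself _ _ ih
  obtain ⟨-, x, hx, hTx⟩ := exists_isSupIn_orbit hVc hmono hcont (hwV 0) (hwV 1).1 fun n => by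
    rw [hsucc]
    exact .of_forall_le (f := fun σ => T σ (w n)) (hself _ _ (hwV n)) (hg _ (hwV n))
  obtain ⟨hxg, hxle⟩ := bellman x hx.1 hTx
  refine ⟨vfix, fun σ => ⟨hmem σ, hfix σ, huniq σ⟩, g x, ?_⟩
  rw [← hxg]
  refine ⟨hxle, hTx, fun y hy hys => bellman_unique y hy x hx.1 hys hTx, fun σ => ⟨fun h τ => ?_,
    fun h => ?_⟩, fun u hu0 hu1 hu => ?_⟩
  · have hσ : vfix σ = x := le_antisymm (hxle σ) (hxg.trans_le (h _))
    have hTσ := hfix σ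
    rw [hσ] at hTσ
    rw [hTσ]
    exact hTx.2.1 _ ⟨τ, rfl⟩
  · have hσ : T σ x = x :=
      (IsSupIn.of_forall_le (f := fun σ => T σ x) (hself σ x hx.1) h).unique hTx
    rw [← huniq σ x hx.1 hσ]
    exact hxle
  · obtain ⟨hum, y, hy, hTy⟩ := exists_isSupIn_orbit hVc hmono hcont hu0 hu1 hu
    rw [bellman_unique x hx.1 y hy.1 hTx hTy]
    exact ⟨hum, hy⟩
end
end

section
/- Let E be a countably Dedekind complete Riesz space and let (E, 𝕋) be a regular affine ADP: each T_σ has the form T_σ v = r_σ + K_σ v for some r_σ ∈ E and order continuous linear operator K_σ on E. Suppose Condition C holds: there exist e ∈ E and ρ ∈ [0,1) with |r_σ| ≤ e and K_σ e ≤ ρe for all σ ∈ Σ. Let V := [−e/(1−ρ), e/(1−ρ)]. Then (i) (V, 𝕋) is an ADP (each T_σ maps V into V), (ii) the fundamental optimality properties (B1)–(B3) hold for (V, 𝕋), and (iii) value function iteration converges in (V, 𝕋): Tⁿv ↑ v* for every v ∈ V with v ≤ Tv. -/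
open Set

noncomputable section

section SequentialOrder

variable {E : Type*} [Lattice E] {a c : E}

/-- In a countably chain complete order interval, an increasing sequence has a supremum, which is
also its supremum in the ambient lattice. -/
theorem exists_isLUB_of_monotone (hac : CountablyChainComplete (Icc a c)) {w : ℕ → E}
    (hw : Monotone w) (hmem : ∀ n, w n ∈ Icc a c) :
    ∃ x ∈ Icc a c, IsLUB (range w) x := by
  obtain ⟨⟨x, hx, hub, hleast⟩, -⟩ := hac.2 (range w) (range_subset_iff.2 hmem)
    (countable_range w) (range_nonempty w) hw.isChain_range
  refine ⟨x, hx, hub, fun z hz => ?_⟩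
  have hzn : ∀ n, w n ≤ z := fun n => hz (mem_range_self n)
  refine (hleast (z ⊓ c) ⟨le_inf ((hmem 0).1.trans (hzn 0)) (hx.1.trans hx.2), inf_le_right⟩
    ?_).trans inf_le_left
  rintro _ ⟨n, rfl⟩
  exact le_inf (hzn n) (hmem n).2

/-- Value iteration from a point that it improves increases to a solution of the Bellman
equation, when the policy operators are order preserving and sequentially order continuous. -/
theorem exists_isLUB_isSupIn_of_iterates (hac : CountablyChainComplete (Icc a c))
    {ι : Type*} {T : ι → E → E} (hmono : ∀ σ, Monotone (T σ))
    (hcont : ∀ σ (v : ℕ → E) (x : E), Monotone v → IsLUB (range v) x →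
      IsLUB (range fun n => T σ (v n)) (T σ x))
    {w : ℕ → E} (hw0 : w 0 ∈ Icc a c) (hw01 : w 0 ≤ w 1)
    (hw : ∀ n, IsSupIn (Icc a c) (range fun σ => T σ (w n)) (w (n + 1))) :
    Monotone w ∧ ∃ x, IsLUB (range w) x ∧ IsSupIn (Icc a c) (range fun σ => T σ x) x := by
  have hmem : ∀ n, w n ∈ Icc a c
    | 0 => hw0
    | n + 1 => (hw n).1
  have hstep : ∀ n σ, T σ (w n) ≤ w (n + 1) := fun n σ => (hw n).2.1 _ (mem_range_self σ)
  have hwm : Monotone w := by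
    refine monotone_nat_of_le_succ fun n => ?_
    induction n with
    | zero => exact hw01
    | succ n ih =>
      refine (hw n).2.2 _ (hmem _) ?_
      rintro _ ⟨σ, rfl⟩
      exact (hmono σ ih).trans (hstep _ σ)
  obtain ⟨x, hx, hlub⟩ := exists_isLUB_of_monotone hac hwm hmem
  have hle : ∀ n, w n ≤ x := fun n => hlub.1 (mem_range_self n)
  refine ⟨hwm, x, hlub, hx, ?_, fun z hz hub => hlub.2 ?_⟩
  · rintro _ ⟨σ, rfl⟩
    refine (hcont σ w x hwm hlub).2 ?_
    rintro _ ⟨n, rfl⟩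
    exact (hstep n σ).trans (hle _)
  · rintro _ ⟨n, rfl⟩
    refine (hwm n.le_succ).trans ((hw n).2.2 z hz ?_)
    rintro _ ⟨σ, rfl⟩
    exact (hmono σ (hle n)).trans (hub _ (mem_range_self σ))

/-- A policy attaining the maximum attains the supremum computed in a set containing its value. -/
theorem IsSupIn.eq_of_forall_le {V : Set E} {ι : Type*} {f : ι → E} {x : E} {σ : ι}
    (h : IsSupIn V (range f) x) (hσ : f σ ∈ V) (hf : ∀ τ, f τ ≤ f σ) : f σ = x := by
  refine le_antisymm (h.2.1 _ (mem_range_self σ)) (h.2.2 _ hσ ?_)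
  rintro _ ⟨τ, rfl⟩
  exact hf τ

end SequentialOrder

section RieszSpace

variable {E : Type*} [AddCommGroup E] [Lattice E] [IsOrderedAddMonoid E] [Module ℝ E]
  [PosSMulMono ℝ E]

/-- Countable Dedekind completeness makes a geometric sequence decrease to zero. -/
theorem nonpos_of_forall_le_pow_smul (hE : ∀ a c : E, CountablyChainComplete (Icc a c))
    {ρ : ℝ} (hρ0 : 0 ≤ ρ) (hρ1 : ρ < 1) {b u : E} (hb : 0 ≤ b)
    (hu : ∀ n : ℕ, u ≤ ρ ^ n • b) : u ≤ 0 := by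
  rcases hρ0.eq_or_lt with rfl | hρ
  · simpa using hu 1
  have hpow : ∀ n : ℕ, 0 ≤ ρ ^ n • b := fun n => smul_nonneg (pow_nonneg hρ0 n) hb
  have hsmul_le : ∀ y : E, 0 ≤ y → ρ • y ≤ y := fun y hy => by
    have h := smul_nonneg (sub_nonneg.2 hρ1.le) hy
    rwa [sub_smul, one_smul, sub_nonneg] at h
  have hanti : Antitone fun n : ℕ => ρ ^ n • b := antitone_nat_of_succ_le fun n => by
    rw [pow_succ', mul_smul]
    exact hsmul_le _ (hpow n)
  have hle : ∀ n : ℕ, ρ ^ n • b ≤ b := fun n => by simpa using hanti n.zero_le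
  obtain ⟨-, x, hx, hlb, hgreatest⟩ := (hE 0 b).2 (range fun n : ℕ => ρ ^ n • b)
    (range_subset_iff.2 fun n => ⟨hpow n, hle n⟩) (countable_range _) (range_nonempty _)
    hanti.isChain_range
  have hinv : ∀ n : ℕ, ρ⁻¹ • x ≤ ρ ^ n • b := fun n => by
    have h := smul_le_smul_of_nonneg_left (hlb _ (mem_range_self (n + 1))) (inv_nonneg.2 hρ0)
    rwa [pow_succ', mul_smul, inv_smul_smul₀ hρ.ne'] at h
  have hxle : ρ⁻¹ • x ≤ x := by
    refine hgreatest _ ⟨smul_nonneg (inv_nonneg.2 hρ0) hx.1, by simpa using hinv 0⟩ ?_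
    rintro _ ⟨n, rfl⟩
    exact hinv n
  have hx0 : x ≤ 0 := by
    have h : (ρ⁻¹ - 1) • x ≤ 0 := by rwa [sub_smul, one_smul, sub_nonpos]
    have hpos : 0 < ρ⁻¹ - 1 := sub_pos.2 ((one_lt_inv₀ hρ).2 hρ1)
    have h' := smul_le_smul_of_nonneg_left h (inv_nonneg.2 hpos.le)
    rwa [inv_smul_smul₀ hpos.ne', smul_zero] at h'
  refine le_sup_left.trans ((hgreatest (u ⊔ 0) ⟨le_sup_right, ?_⟩ ?_).trans hx0)
  · exact sup_le (by simpa using hu 0) hb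
  · rintro _ ⟨n, rfl⟩
    exact sup_le (hu n) (hpow n)

/-- A vector dominated by its image under a positive operator that contracts an upper bound of
the vector is nonpositive. -/
theorem nonpos_of_le_map (hE : ∀ a c : E, CountablyChainComplete (Icc a c))
    {ρ : ℝ} (hρ0 : 0 ≤ ρ) (hρ1 : ρ < 1) {K : E →ₗ[ℝ] E} (hK : Monotone K) {b u : E}
    (hb : 0 ≤ b) (hKb : K b ≤ ρ • b) (hub : u ≤ b) (hu : u ≤ K u) : u ≤ 0 := by
  refine nonpos_of_forall_le_pow_smul hE hρ0 hρ1 hb fun n => ?_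
  induction n with
  | zero => simpa using hub
  | succ n ih =>
    calc u ≤ K u := hu
      _ ≤ K (ρ ^ n • b) := hK ih
      _ = ρ ^ n • K b := map_smul K _ _
      _ ≤ ρ ^ n • ρ • b := smul_le_smul_of_nonneg_left hKb (pow_nonneg hρ0 n)
      _ = ρ ^ (n + 1) • b := by rw [pow_succ, mul_smul]

end RieszSpace

/-- Theorem t:rieszaff: let `E` be a countably Dedekind complete Riesz space and let
`(E, 𝕋)` be a regular affine ADP: each policy operator has the form
`T σ v = r σ + K σ v` with `K σ` an order continuous linear operator.  Suppose
Condition C holds: there are `e ∈ E` and `ρ ∈ [0,1)` with `|r σ| ≤ e` and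
`K σ e ≤ ρ e` for all `σ`.  Let `V = [-e/(1-ρ), e/(1-ρ)]`.  Then (i) `(V, 𝕋)` is an
ADP (each `T σ` maps `V` into `V`), (ii) the fundamental optimality properties
(B1)–(B3) hold for `(V, 𝕋)` (in particular `(V, 𝕋)` is well-posed), and (iii) value
function iteration converges in `(V, 𝕋)`. -/
theorem stmt13 {E : Type*} [AddCommGroup E] [Lattice E]
    [CovariantClass E E (· + ·) (· ≤ ·)] [Module ℝ E] [PosSMulMono ℝ E]
    (hE : ∀ a c : E, CountablyChainComplete (Set.Icc a c))
    {Pol : Type*} [Nonempty Pol] (T : Pol → E → E)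
    (hmonoE : ∀ σ, Monotone (T σ))
    (hregE : ∀ v : E, ∃ σ, ∀ τ, T τ v ≤ T σ v)
    (r : Pol → E) (K : Pol → E →ₗ[ℝ] E)
    (hKoc : ∀ σ, OrderContinuousLin (K σ))
    (hT : ∀ σ v, T σ v = r σ + K σ v)
    (e : E) (ρ : ℝ) (hρ0 : 0 ≤ ρ) (hρ1 : ρ < 1)
    (hre : ∀ σ, |r σ| ≤ e) (hKe : ∀ σ, K σ e ≤ ρ • e)
    (V : Set E) (hV : V = Set.Icc (-((1 - ρ)⁻¹ • e)) ((1 - ρ)⁻¹ • e)) :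
    -- (i) (V, 𝕋) is an ADP: each T σ is a self-map on V
    (∀ σ, ∀ v ∈ V, T σ v ∈ V) ∧
    ∃ vfix : Pol → E,
      -- well-posedness: each policy operator has a unique fixed point in V
      (∀ σ, vfix σ ∈ V ∧ T σ (vfix σ) = vfix σ ∧
        ∀ w ∈ V, T σ w = w → w = vfix σ) ∧
      -- (B1): an optimal policy exists, and v* = vfix σopt is the value function
      ∃ σopt : Pol, (∀ τ, vfix τ ≤ vfix σopt) ∧
        -- (B2): v* is the unique solution of the Bellman equation in V
        IsSupIn V (Set.range fun σ => T σ (vfix σopt)) (vfix σopt) ∧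
        (∀ w ∈ V, IsSupIn V (Set.range fun σ => T σ w) w → w = vfix σopt) ∧
        -- (B3): Bellman's principle of optimality
        (∀ σ, (∀ τ, vfix τ ≤ vfix σ) ↔ (∀ τ, T τ (vfix σopt) ≤ T σ (vfix σopt))) ∧
        -- (iii) convergence of VFI
        ∀ w : ℕ → E, w 0 ∈ V → w 0 ≤ w 1 →
          (∀ n, IsSupIn V (Set.range fun σ => T σ (w n)) (w (n + 1))) →
          Monotone w ∧ IsSupIn V (Set.range w) (vfix σopt) := by
  have : IsOrderedAddMonoid E := { add_le_add_left := fun _ _ h c => add_le_add_left h c }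
  obtain ⟨b, hb⟩ : ∃ b, b = (1 - ρ)⁻¹ • e := ⟨_, rfl⟩
  rw [← hb] at hV
  subst hV
  have hρ' : 0 < 1 - ρ := sub_pos.2 hρ1
  have he : 0 ≤ e := (abs_nonneg _).trans (hre (Classical.arbitrary Pol))
  have hb0 : 0 ≤ b := hb ▸ smul_nonneg (inv_nonneg.2 hρ'.le) he
  have heb : e + ρ • b = b := by
    have h : e = (1 - ρ) • b := by rw [hb, smul_inv_smul₀ hρ'.ne']
    rw [h, ← add_smul, sub_add_cancel, one_smul]
  have hKmono : ∀ σ, Monotone (K σ) := fun σ x y hxy => by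
    have h := hmonoE σ hxy
    rwa [hT, hT, add_le_add_iff_left] at h
  have hKb : ∀ σ, K σ b ≤ ρ • b := fun σ => by
    rw [hb, map_smul, smul_comm]
    exact smul_le_smul_of_nonneg_left (hKe σ) (inv_nonneg.2 hρ'.le)
  have hmaps : ∀ σ, ∀ v ∈ Icc (-b) b, T σ v ∈ Icc (-b) b := by
    refine fun σ v hv => ⟨le_trans ?_ (hmonoE σ hv.1), (hmonoE σ hv.2).trans ?_⟩
    · rw [hT, map_neg, ← heb, neg_add, heb]
      exact add_le_add (neg_le.1 ((neg_le_abs _).trans (hre σ))) (neg_le_neg (hKb σ))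
    · rw [hT]
      exact (add_le_add ((le_abs_self _).trans (hre σ)) (hKb σ)).trans_eq heb
  have hcont : ∀ σ (v : ℕ → E) (x : E), Monotone v → IsLUB (range v) x →
      IsLUB (range fun n => T σ (v n)) (T σ x) := fun σ v x hv hx => by
    have h := (OrderIso.addLeft (r σ)).isLUB_image'.2 (hKoc σ v x hv hx)
    rw [← range_comp] at h
    simpa only [hT, Function.comp_def, OrderIso.addLeft_apply] using h
  have hcompare : ∀ σ, ∀ v ∈ Icc (-b) b, ∀ w ∈ Icc (-b) b, v ≤ T σ v → T σ w ≤ w → v ≤ w := by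
    intro σ v hv w hw hvT hwT
    refine sub_nonpos.1 (nonpos_of_le_map hE hρ0 hρ1 (hKmono σ) (add_nonneg hb0 hb0) ?_ ?_ ?_)
    · rw [map_add, smul_add]
      exact add_le_add (hKb σ) (hKb σ)
    · rw [sub_eq_add_neg]
      exact add_le_add hv.2 (neg_le.1 hw.1)
    · have h := sub_le_sub hvT hwT
      rwa [hT, hT, add_sub_add_left_eq_sub, ← map_sub] at h
  have hbot : -b ∈ Icc (-b) b := left_mem_Icc.2 (neg_le_self hb0)
  have hexists : ∀ {ι : Type _} (p : ι → Pol) (g : E → ι)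
      (_ : ∀ v i, T (p i) v ≤ T (p (g v)) v),
      ∃ x ∈ Icc (-b) b, IsSupIn (Icc (-b) b) (range fun i => T (p i) x) x := by
    intro ι p g hg
    let S : E → E := fun v => T (p (g v)) v
    have hmem : ∀ n, S^[n] (-b) ∈ Icc (-b) b := fun n => by
      induction n with
      | zero => exact hbot
      | succ n ih =>
        rw [Function.iterate_succ_apply']
        exact hmaps _ _ ih
    obtain ⟨-, x, -, hx⟩ := exists_isLUB_isSupIn_of_iterates (hE (-b) b)
      (fun i => hmonoE (p i)) (fun i => hcont (p i)) (w := fun n => S^[n] (-b)) hbot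
      (hmem 1).1 fun n => by
        refine ⟨hmem _, ?_, fun z _ hz => ?_⟩
        · rintro _ ⟨i, rfl⟩
          simp only [Function.iterate_succ_apply']
          exact hg _ i
        · simp only [Function.iterate_succ_apply']
          exact hz _ (mem_range_self (g (S^[n] (-b))))
    exact ⟨x, hx.1, hx⟩
  have hfix : ∀ σ, ∃ x ∈ Icc (-b) b, T σ x = x := fun σ => by
    obtain ⟨x, hx, hsup⟩ := hexists (fun _ : Pol => σ) (fun _ => σ) fun _ _ => le_rfl
    exact ⟨x, hx, hsup.eq_of_forall_le (σ := σ) (hmaps σ x hx) fun _ => le_rfl⟩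
  choose vfix hvmem hvfix using hfix
  have huniq : ∀ σ, ∀ w ∈ Icc (-b) b, T σ w = w → w = vfix σ := fun σ w hw h =>
    le_antisymm (hcompare σ w hw _ (hvmem σ) h.ge (hvfix σ).le)
      (hcompare σ _ (hvmem σ) w hw (hvfix σ).ge h.le)
  choose g hg using hregE
  have hbellman : ∀ w ∈ Icc (-b) b, IsSupIn (Icc (-b) b) (range fun σ => T σ w) w →
      w = vfix (g w) ∧ ∀ τ, vfix τ ≤ w := fun w hw h =>
    ⟨huniq _ w hw (h.eq_of_forall_le (hmaps (g w) w hw) (hg w)), fun τ =>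
      hcompare τ _ (hvmem τ) w hw (hvfix τ).ge (h.2.1 _ (mem_range_self τ))⟩
  obtain ⟨v, hv, hsup⟩ := hexists id g hg
  obtain ⟨hveq, hvmax⟩ := hbellman v hv hsup
  have hunique : ∀ w ∈ Icc (-b) b, IsSupIn (Icc (-b) b) (range fun σ => T σ w) w → w = v := by
    intro w hw h
    obtain ⟨hweq, hwmax⟩ := hbellman w hw h
    exact le_antisymm (hweq ▸ hvmax _) (hveq ▸ hwmax _)
  refine ⟨hmaps, vfix, fun σ => ⟨hvmem σ, hvfix σ, huniq σ⟩, g v, ?_⟩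
  rw [← hveq]
  refine ⟨hvmax, hsup, hunique, fun σ => ⟨fun h τ => ?_, fun h τ => ?_⟩, fun w hw0 hw01 hw => ?_⟩
  · have hσ : vfix σ = v := le_antisymm (hvmax σ) (hveq.le.trans (h (g v)))
    exact (hsup.2.1 _ (mem_range_self τ)).trans_eq (hσ ▸ (hvfix σ).symm)
  · rw [← huniq σ v hv (hsup.eq_of_forall_le (hmaps σ v hv) h)]
    exact hvmax τ
  · obtain ⟨hwm, x, hlub, hx⟩ := exists_isLUB_isSupIn_of_iterates (hE (-b) b) hmonoE hcont
      hw0 hw01 hw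
    obtain rfl := hunique x hx.1 hx
    exact ⟨hwm, hx.1, hlub.1, fun z _ hz => hlub.2 hz⟩
end
end

section
/- Let Y, Z, A be finite sets, X := Y × Z, let Γ : X → nonempty subsets of A be a feasible correspondence with G := {(x,a) : a ∈ Γ(x)}, let H : Y × A × Z → Y, let P be a stochastic matrix on Z, let r : G → ℝ, let β ∈ (0,1), and let τ ∈ (0,1). For a policy σ : X → A with σ(x) ∈ Γ(x) for all x, define S_σ on ℝ^G by (S_σ q)(x, a) = r(x,a) + β·min{k ∈ ℝ : Σ_{z′∈Z} 1{q(x′, σ(x′)) ≤ k}·P(z, z′) ≥ τ}, where x = (y,z) and x′ = (H(y,a,z′), z′). Then for all q, f ∈ ℝ^G and all n ∈ ℕ, |S_σⁿ q − S_σⁿ f| ≤ βⁿ·sup_{(x,a)∈G} |q(x,a) − f(x,a)| pointwise on G; consequently |S_σⁿ q − S_σⁿ f| →o 0 as n → ∞. -/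
open Set

noncomputable section

/-- The levels whose cumulative weight reaches `τ > 0` are bounded below. -/
theorem bddBelow_quantileSet {ι : Type*} [Fintype ι] [Nonempty ι] (p u : ι → ℝ)
    {τ : ℝ} (hτ : 0 < τ) :
    BddBelow {k : ℝ | τ ≤ ∑ i, (if u i ≤ k then p i else 0)} := by
  refine ⟨Finset.univ.inf' Finset.univ_nonempty u, fun k hk => ?_⟩
  by_contra! hlt
  have hzero : ∑ i, (if u i ≤ k then p i else 0) = 0 := by
    refine Finset.sum_eq_zero fun i hi => if_neg (not_le.mpr ?_)
    exact hlt.trans_le (Finset.inf'_le u hi)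
  rw [mem_ofPred_eq, hzero] at hk
  exact absurd hk (not_le.mpr hτ)

/-- The quantile set of a finite probability distribution is nonempty. -/
theorem nonempty_quantileSet {ι : Type*} [Fintype ι] [Nonempty ι] {p : ι → ℝ}
    (hsum : ∑ i, p i = 1) (u : ι → ℝ) {τ : ℝ} (hτ : τ ≤ 1) :
    {k : ℝ | τ ≤ ∑ i, (if u i ≤ k then p i else 0)}.Nonempty := by
  refine ⟨Finset.univ.sup' Finset.univ_nonempty u, ?_⟩
  have hone : ∑ i, (if u i ≤ Finset.univ.sup' Finset.univ_nonempty u then p i else 0) = 1 := by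
    rw [← hsum]
    exact Finset.sum_congr rfl fun i hi => if_pos (Finset.le_sup' u hi)
  rw [mem_ofPred_eq, hone]
  exact hτ

/-- Quantiles are monotone up to additive constants. -/
theorem sInf_quantileSet_le_add {ι : Type*} [Fintype ι] [Nonempty ι] {p : ι → ℝ}
    (hp : ∀ i, 0 ≤ p i) (hsum : ∑ i, p i = 1) {u v : ι → ℝ} {τ C : ℝ}
    (hτ0 : 0 < τ) (hτ1 : τ ≤ 1) (h : ∀ i, u i ≤ v i + C) :
    sInf {k : ℝ | τ ≤ ∑ i, (if u i ≤ k then p i else 0)} ≤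
      sInf {k : ℝ | τ ≤ ∑ i, (if v i ≤ k then p i else 0)} + C := by
  rw [← sub_le_iff_le_add]
  refine le_csInf (nonempty_quantileSet hsum v hτ1) fun k hk => ?_
  rw [sub_le_iff_le_add]
  refine csInf_le (bddBelow_quantileSet p u hτ0) ?_
  refine le_trans (mem_ofPred_eq ▸ hk) (Finset.sum_le_sum fun i _ => ?_)
  by_cases hv : v i ≤ k
  · rw [if_pos hv, if_pos ((h i).trans (by gcongr))]
  · rw [if_neg hv]
    split_ifs
    exacts [hp i, le_rfl]

/-- Quantiles are nonexpansive in the supremum norm. -/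
theorem abs_sInf_quantileSet_sub_le {ι : Type*} [Fintype ι] [Nonempty ι] {p : ι → ℝ}
    (hp : ∀ i, 0 ≤ p i) (hsum : ∑ i, p i = 1) {u v : ι → ℝ} {τ C : ℝ}
    (hτ0 : 0 < τ) (hτ1 : τ ≤ 1) (h : ∀ i, |u i - v i| ≤ C) :
    |sInf {k : ℝ | τ ≤ ∑ i, (if u i ≤ k then p i else 0)} -
      sInf {k : ℝ | τ ≤ ∑ i, (if v i ≤ k then p i else 0)}| ≤ C := by
  have huv := sInf_quantileSet_le_add hp hsum (u := u) (v := v) (C := C) hτ0 hτ1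
    fun i => by linarith [(abs_le.mp (h i)).2]
  have hvu := sInf_quantileSet_le_add hp hsum (u := v) (v := u) (C := C) hτ0 hτ1
    fun i => by linarith [(abs_le.mp (h i)).1]
  rw [abs_le]
  constructor <;> linarith

/-- Lemma l:q_c: the quantile policy operator `S_σ` of the Q-factor quantile MDP
satisfies `|S_σⁿ q - S_σⁿ f| ≤ βⁿ sup_{(x,a) ∈ G} |q - f|` pointwise on `G`, and
consequently `|S_σⁿ q - S_σⁿ f| →o 0`. -/
theorem stmt17 {Y Z A : Type*} [Fintype Y] [Fintype Z] [Fintype A]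
    [Nonempty Y] [Nonempty Z]
    (Γ : Y × Z → Finset A) (hΓ : ∀ x, (Γ x).Nonempty)
    (H : Y → A → Z → Y) (P : Z → Z → ℝ)
    (hPpos : ∀ z z', 0 ≤ P z z') (hPsum : ∀ z, ∑ z', P z z' = 1)
    (r : {p : (Y × Z) × A // p.2 ∈ Γ p.1} → ℝ)
    (β : ℝ) (hβ0 : 0 < β) (hβ1 : β < 1)
    (τ : ℝ) (hτ0 : 0 < τ) (hτ1 : τ < 1)
    (σ : Y × Z → A) (hσ : ∀ x, σ x ∈ Γ x)
    (Sσ : ({p : (Y × Z) × A // p.2 ∈ Γ p.1} → ℝ) →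
      ({p : (Y × Z) × A // p.2 ∈ Γ p.1} → ℝ))
    (hSσ : ∀ (q : {p : (Y × Z) × A // p.2 ∈ Γ p.1} → ℝ) g, Sσ q g =
      r g + β * sInf {k : ℝ | τ ≤ ∑ z' : Z,
        (if q ⟨((H g.1.1.1 g.1.2 z', z'), σ (H g.1.1.1 g.1.2 z', z')),
              hσ (H g.1.1.1 g.1.2 z', z')⟩ ≤ k
         then P g.1.1.2 z' else 0)}) :
    ∀ q f : {p : (Y × Z) × A // p.2 ∈ Γ p.1} → ℝ,
      (∀ (n : ℕ) g, |Sσ^[n] q g - Sσ^[n] f g| ≤ β ^ n * ⨆ g', |q g' - f g'|) ∧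
      ∃ d : ℕ → ({p : (Y × Z) × A // p.2 ∈ Γ p.1} → ℝ),
        Antitone d ∧ IsGLB (Set.range d) 0 ∧
        ∀ (n : ℕ) g, |Sσ^[n] q g - Sσ^[n] f g| ≤ d n g := by
  intro q f
  set C : ℝ := ⨆ g', |q g' - f g'|
  have hC : 0 ≤ C := Real.iSup_nonneg fun g => abs_nonneg _
  have key : ∀ (n : ℕ) g, |Sσ^[n] q g - Sσ^[n] f g| ≤ β ^ n * C := by
    intro n
    induction n with
    | zero =>
      intro g
      simpa using le_ciSup (f := fun g' => |q g' - f g'|) (Set.finite_range _).bddAbove g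
    | succ n ih =>
      intro g
      rw [Function.iterate_succ_apply', Function.iterate_succ_apply', hSσ, hSσ,
        add_sub_add_left_eq_sub, ← mul_sub, abs_mul, abs_of_pos hβ0, pow_succ', mul_assoc]
      exact mul_le_mul_of_nonneg_left
        (abs_sInf_quantileSet_sub_le (hPpos g.1.1.2) (hPsum g.1.1.2) hτ0 hτ1.le
          fun z' => ih _) hβ0.le
  refine ⟨key, fun n _ => β ^ n * C, fun m n hmn g => ?_, ⟨?_, fun b hb g => ?_⟩, key⟩
  · exact mul_le_mul_of_nonneg_right (pow_le_pow_of_le_one hβ0.le hβ1.le hmn) hC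
  · rintro _ ⟨n, rfl⟩ g
    exact mul_nonneg (pow_nonneg hβ0.le n) hC
  · have hlim : Filter.Tendsto (fun n : ℕ => β ^ n * C) Filter.atTop (nhds 0) := by
      simpa using (tendsto_pow_atTop_nhds_zero_of_lt_one hβ0.le hβ1).mul_const C
    exact ge_of_tendsto' hlim fun n => hb ⟨n, rfl⟩ g
end
end

section
/- Let Y, Z, A be finite sets, X := Y × Z, let Γ : X → nonempty subsets of A with G := {(x,a) : a ∈ Γ(x)}, let H : Y × A × Z → Y, let P be a stochastic matrix on Z, let r : G → ℝ with infimum r̲ and supremum r̄, let β ∈ (0,1), and τ ∈ (0,1). Let Σ be the set of maps σ : X → A with σ(x) ∈ Γ(x) for all x, and for σ ∈ Σ define S_σ on ℝ^G by (S_σ q)(x,a) = r(x,a) + β·min{k ∈ ℝ : Σ_{z′} 1{q(x′, σ(x′)) ≤ k}·P(z,z′) ≥ τ}, where x = (y,z) and x′ = (H(y,a,z′), z′). Let V := [r̲/(1−β), r̄/(1−β)] ⊂ ℝ^G. Then: (i) Σ is nonempty; (ii) each S_σ is order preserving on ℝ^G; (iii) each S_σ maps V into V; and (iv) for every q ∈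 V there exists σ ∈ Σ with S_τ q ≤ S_σ q for all τ ∈ Σ (a q-greedy policy exists). Hence (V, {S_σ : σ ∈ Σ}) is a regular ADP. -/
open Set

noncomputable section

section Quantile

variable {Z : Type*} [Fintype Z] {w : Z → ℝ} {τ : ℝ} {f g : Z → ℝ} {m M : ℝ}

/-- The levels at which the distribution function of `f` under the weights `w` is at least `τ`;
its infimum is the `τ`-quantile of `f`. -/
def quantileSet (w : Z → ℝ) (τ : ℝ) (f : Z → ℝ) : Set ℝ :=
  {k : ℝ | τ ≤ ∑ z, (if f z ≤ k then w z else 0)}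

lemma mem_quantileSet_of_le (hsum : ∑ z, w z = 1) (hτ : τ ≤ 1) (hM : ∀ z, f z ≤ M) :
    M ∈ quantileSet w τ f := by
  simp [quantileSet, hM, hsum, hτ]

lemma le_of_mem_quantileSet (hτ : 0 < τ) (hm : ∀ z, m ≤ f z) {k : ℝ}
    (hk : k ∈ quantileSet w τ f) : m ≤ k := by
  by_contra! hlt
  have hzero : ∑ z, (if f z ≤ k then w z else 0) = 0 :=
    Finset.sum_eq_zero fun z _ => if_neg (hlt.trans_le (hm z)).not_ge
  have hle : τ ≤ ∑ z, (if f z ≤ k then w z else 0) := hk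
  linarith

lemma quantileSet_nonempty (hsum : ∑ z, w z = 1) (hτ : τ ≤ 1) :
    (quantileSet w τ f).Nonempty := by
  obtain ⟨M, hM⟩ := (Set.finite_range f).bddAbove
  exact ⟨M, mem_quantileSet_of_le hsum hτ fun z => hM ⟨z, rfl⟩⟩

lemma bddBelow_quantileSet_s18 (hτ : 0 < τ) : BddBelow (quantileSet w τ f) := by
  obtain ⟨m, hm⟩ := (Set.finite_range f).bddBelow
  exact ⟨m, fun _ hk => le_of_mem_quantileSet hτ (fun z => hm ⟨z, rfl⟩) hk⟩

lemma sInf_quantileSet_mono (hw : ∀ z, 0 ≤ w z) (hsum : ∑ z, w z = 1) (hτ0 : 0 < τ)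
    (hτ1 : τ ≤ 1) (hfg : ∀ z, f z ≤ g z) :
    sInf (quantileSet w τ f) ≤ sInf (quantileSet w τ g) := by
  refine csInf_le_csInf (bddBelow_quantileSet_s18 hτ0) (quantileSet_nonempty hsum hτ1) ?_
  intro k hk
  refine le_trans (show τ ≤ _ from hk) (Finset.sum_le_sum fun z _ => ?_)
  by_cases h : g z ≤ k
  · simp [h, (hfg z).trans h]
  · rw [if_neg h]
    split_ifs
    exacts [hw z, le_rfl]

lemma sInf_quantileSet_le (hsum : ∑ z, w z = 1) (hτ0 : 0 < τ) (hτ1 : τ ≤ 1)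
    (hM : ∀ z, f z ≤ M) : sInf (quantileSet w τ f) ≤ M :=
  csInf_le (bddBelow_quantileSet_s18 hτ0) (mem_quantileSet_of_le hsum hτ1 hM)

lemma le_sInf_quantileSet (hsum : ∑ z, w z = 1) (hτ0 : 0 < τ) (hτ1 : τ ≤ 1)
    (hm : ∀ z, m ≤ f z) : m ≤ sInf (quantileSet w τ f) :=
  le_csInf (quantileSet_nonempty hsum hτ1) fun _ hk => le_of_mem_quantileSet hτ0 hm hk

end Quantile

/-- Lemma l:q_radp: the quantile Q-factor dynamic program is a regular ADP.  With
finite `Y, Z, A`, feasible correspondence `Γ`, stochastic matrix `P`, reward `r`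
(with infimum `r̲` and supremum `r̄`), `β, τ ∈ (0,1)` and policy operators `S σ`,
on the value space `V = [r̲/(1-β), r̄/(1-β)] ⊂ ℝ^G`: (i) the policy set is
nonempty; (ii) each `S σ` is order preserving on `ℝ^G`; (iii) each `S σ` maps `V`
into `V`; (iv) for every `q ∈ V` a `q`-greedy policy exists. -/
theorem stmt18 {Y Z A : Type*} [Fintype Y] [Fintype Z] [Fintype A]
    [Nonempty Y] [Nonempty Z]
    (Γ : Y × Z → Finset A) (hΓ : ∀ x, (Γ x).Nonempty)
    (H : Y → A → Z → Y) (P : Z → Z → ℝ)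
    (hPpos : ∀ z z', 0 ≤ P z z') (hPsum : ∀ z, ∑ z', P z z' = 1)
    (r : {p : (Y × Z) × A // p.2 ∈ Γ p.1} → ℝ)
    (β : ℝ) (hβ0 : 0 < β) (hβ1 : β < 1)
    (τ : ℝ) (hτ0 : 0 < τ) (hτ1 : τ < 1)
    (S : {σ : Y × Z → A // ∀ x, σ x ∈ Γ x} →
      ({p : (Y × Z) × A // p.2 ∈ Γ p.1} → ℝ) →
      ({p : (Y × Z) × A // p.2 ∈ Γ p.1} → ℝ))
    (hS : ∀ (σ : {σ : Y × Z → A // ∀ x, σ x ∈ Γ x})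
        (q : {p : (Y × Z) × A // p.2 ∈ Γ p.1} → ℝ) g, S σ q g =
      r g + β * sInf {k : ℝ | τ ≤ ∑ z' : Z,
        (if q ⟨((H g.1.1.1 g.1.2 z', z'), σ.1 (H g.1.1.1 g.1.2 z', z')),
              σ.2 (H g.1.1.1 g.1.2 z', z')⟩ ≤ k
         then P g.1.1.2 z' else 0)})
    (V : Set ({p : (Y × Z) × A // p.2 ∈ Γ p.1} → ℝ))
    (hV : V = Set.Icc (fun _ => (⨅ g, r g) / (1 - β)) (fun _ => (⨆ g, r g) / (1 - β))) :
    -- (i) the set of feasible policies is nonempty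
    Nonempty {σ : Y × Z → A // ∀ x, σ x ∈ Γ x} ∧
    -- (ii) each S σ is order preserving on ℝ^G
    (∀ σ q f, q ≤ f → S σ q ≤ S σ f) ∧
    -- (iii) each S σ is a self-map on V
    (∀ σ, ∀ q ∈ V, S σ q ∈ V) ∧
    -- (iv) a q-greedy policy exists for every q ∈ V
    ∀ q ∈ V, ∃ σ, ∀ τ', S τ' q ≤ S σ q := by
  have hS' : ∀ σ q g, S σ q g = r g + β * sInf (quantileSet (P g.1.1.2) τ fun z' =>
      q ⟨((H g.1.1.1 g.1.2 z', z'), σ.1 (H g.1.1.1 g.1.2 z', z')),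
        σ.2 (H g.1.1.1 g.1.2 z', z')⟩) := hS
  have h1β : 0 < 1 - β := sub_pos.2 hβ1
  have hfix : ∀ c : ℝ, c + β * (c / (1 - β)) = c / (1 - β) := fun c => by
    field_simp
    ring
  refine ⟨⟨fun x => (hΓ x).choose, fun x => (hΓ x).choose_spec⟩, ?_, ?_, ?_⟩
  · intro σ q f hqf g
    rw [hS', hS']
    refine add_le_add_right (mul_le_mul_of_nonneg_left ?_ hβ0.le) _
    exact sInf_quantileSet_mono (hPpos _) (hPsum _) hτ0 hτ1.le fun _ => hqf _
  · subst hV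
    rintro σ q ⟨hlo, hhi⟩
    refine ⟨fun g => ?_, fun g => ?_⟩
    · rw [hS', ← hfix]
      refine add_le_add ?_ (mul_le_mul_of_nonneg_left ?_ hβ0.le)
      · exact ciInf_le (Set.finite_range r).bddBelow g
      · exact le_sInf_quantileSet (hPsum _) hτ0 hτ1.le fun _ => hlo _
    · rw [hS', ← hfix]
      refine add_le_add ?_ (mul_le_mul_of_nonneg_left ?_ hβ0.le)
      · exact le_ciSup (Set.finite_range r).bddAbove g
      · exact sInf_quantileSet_le (hPsum _) hτ0 hτ1.le fun _ => hhi _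
  · intro q _
    have hmax : ∀ x, ∃ a : {a // a ∈ Γ x}, ∀ b : {b // b ∈ Γ x},
        q ⟨(x, b.1), b.2⟩ ≤ q ⟨(x, a.1), a.2⟩ := fun x =>
      haveI : Nonempty {a // a ∈ Γ x} := (hΓ x).to_subtype
      Finite.exists_max fun a : {a // a ∈ Γ x} => q ⟨(x, a.1), a.2⟩
    choose a ha using hmax
    refine ⟨⟨fun x => (a x).1, fun x => (a x).2⟩, fun τ' g => ?_⟩
    rw [hS', hS']
    refine add_le_add_right (mul_le_mul_of_nonneg_left ?_ hβ0.le) _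
    exact sInf_quantileSet_mono (hPpos _) (hPsum _) hτ0 hτ1.le fun z' =>
      ha _ ⟨τ'.1 (H g.1.1.1 g.1.2 z', z'), τ'.2 _⟩
end
end
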